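/- 114689 divides the class number of the compositum ℚ(2^{10})·ℚ(114689), where ℚ(2^{10}) is the maximal real subfield of ℚ(ζ_{2^{12}}) (the 10-th layer of the cyclotomic ℤ_2-extension of ℚ); equivalently, the 114689-class group of ℚ(2^{10})·ℚ(114689) is nontrivial. -/

import Mathlib

open NumberField

section EllipticCurvePrimality

open WeierstrassCurve.Affine

variable {F : Type*} [Field F] [DecidableEq F]

/-- The short Weierstrass curve `y² = x³ + a x + b`. -/
abbrev shortCurve (a b : F) : WeierstrassCurve.Affine F := ⟨0, 0, 0, a, b⟩

/-- `(X : Y : Z)` are Jacobian coordinates of `P`. -/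
def HasJacobian {a b : F} (P : (shortCurve a b).Point) (X Y Z : F) : Prop :=
  ∃ x y h, P = .some x y h ∧ X = x * Z ^ 2 ∧ Y = y * Z ^ 3

theorem HasJacobian.double {a b : F} {P : (shortCurve a b).Point} {X Y Z : F}
    (h : HasJacobian P X Y Z) (hZ : 2 * Y * Z ≠ 0) :
    HasJacobian (P + P)
      ((3 * X ^ 2 + a * Z ^ 4) ^ 2 - 8 * X * Y ^ 2)
      ((3 * X ^ 2 + a * Z ^ 4) *
        (4 * X * Y ^ 2 - ((3 * X ^ 2 + a * Z ^ 4) ^ 2 - 8 * X * Y ^ 2)) - 8 * Y ^ 4)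
      (2 * Y * Z) := by
  obtain ⟨x, y, hxy, rfl, rfl, rfl⟩ := h
  have h2 : (2 : F) ≠ 0 := fun h => hZ (by rw [h]; ring)
  have hz : Z ≠ 0 := fun h => hZ (by rw [h]; ring)
  have hy : y ≠ 0 := fun h => hZ (by rw [h]; ring)
  have hyy : y ≠ (shortCurve a b).negY x y := by
    simp only [negY, zero_mul, sub_zero]
    intro h
    exact mul_ne_zero h2 hy (by linear_combination h)
  refine ⟨_, _, _, Point.add_self_of_Y_ne hyy, ?_, ?_⟩
  · rw [slope_of_Y_ne rfl hyy]
    simp only [negY, addX]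
    have : y - (-y - 0 * x - 0) = 2 * y := by ring
    rw [this]
    field_simp
    ring
  · rw [slope_of_Y_ne rfl hyy]
    simp only [negY, addY, negAddY, addX]
    have : y - (-y - 0 * x - 0) = 2 * y := by ring
    rw [this]
    field_simp
    ring

theorem HasJacobian.add_some {a b : F} {P : (shortCurve a b).Point} {X Y Z x₀ y₀ : F}
    (h : HasJacobian P X Y Z) (h₀ : (shortCurve a b).Nonsingular x₀ y₀)
    (hZ : Z * (x₀ * Z ^ 2 - X) ≠ 0) :
    HasJacobian (P + .some x₀ y₀ h₀)
      ((y₀ * Z ^ 3 - Y) ^ 2 - (x₀ * Z ^ 2 - X) ^ 3 - 2 * X * (x₀ * Z ^ 2 - X) ^ 2)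
      ((y₀ * Z ^ 3 - Y) * (X * (x₀ * Z ^ 2 - X) ^ 2 -
        ((y₀ * Z ^ 3 - Y) ^ 2 - (x₀ * Z ^ 2 - X) ^ 3 - 2 * X * (x₀ * Z ^ 2 - X) ^ 2)) -
        Y * (x₀ * Z ^ 2 - X) ^ 3)
      (Z * (x₀ * Z ^ 2 - X)) := by
  obtain ⟨x, y, hxy, rfl, rfl, rfl⟩ := h
  have hz : Z ≠ 0 := fun h => hZ (by rw [h]; ring)
  have hx : x ≠ x₀ := fun h => hZ (by rw [h]; ring)
  have hx' : x₀ - x ≠ 0 := sub_ne_zero.mpr hx.symm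
  have hx'' : x - x₀ ≠ 0 := sub_ne_zero.mpr hx
  refine ⟨_, _, _, Point.add_of_X_ne hx, ?_, ?_⟩
  · rw [slope_of_X_ne hx]
    simp only [addX]
    field_simp
    ring
  · rw [slope_of_X_ne hx]
    simp only [negY, addY, negAddY, addX]
    field_simp
    ring

/-- A point of prime order on a curve over a finite field has order at most `2 |F| + 1`. -/
theorem addOrderOf_point_le [Fintype F] {a b : F} (Q : (shortCurve a b).Point)
    (hQ : Odd (addOrderOf Q)) : addOrderOf Q ≤ 2 * Fintype.card F + 1 := by
  obtain ⟨t, ht⟩ := hQ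
  have hne : ∀ k ∈ Finset.Icc 1 t, k • Q ≠ 0 := by
    intro k hk h
    rw [Finset.mem_Icc] at hk
    have := Nat.le_of_dvd (by omega) (addOrderOf_dvd_of_nsmul_eq_zero h)
    omega
  have hsome : ∀ P : (shortCurve a b).Point, P ≠ 0 → ∃ x y h, P = .some x y h := by
    rintro (_ | ⟨x, y, h⟩) hP
    · exact absurd rfl hP
    · exact ⟨x, y, h, rfl⟩
  have hinj : Set.InjOn (fun k : ℕ => (k • Q).xRep 0) (Finset.Icc 1 t : Finset ℕ) := by
    intro j hj k hk hjk
    obtain ⟨x, y, h, e⟩ := hsome _ (hne j hj)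
    obtain ⟨x', y', h', e'⟩ := hsome _ (hne k hk)
    rw [Finset.coe_Icc, Set.mem_Icc] at hj hk
    simp only [e, e', Point.xRep_some, Matrix.cons_val_zero] at hjk
    have hx : (j • Q).xRep = (k • Q).xRep := by
      rw [e, e', Point.xRep_some, Point.xRep_some, hjk]
    rcases Point.eq_or_eq_neg_of_xRep_eq_xRep hx with h | h
    · exact nsmul_injOn_Iio_addOrderOf (Set.mem_Iio.mpr (by omega)) (Set.mem_Iio.mpr (by omega)) h
    · have h0 : (j + k) • Q = 0 := by rw [add_nsmul, h, neg_add_cancel]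
      have := Nat.le_of_dvd (by omega) (addOrderOf_dvd_of_nsmul_eq_zero h0)
      omega
  have := Finset.card_le_card_of_injOn (t := (Finset.univ : Finset F)) _
    (fun _ _ => Finset.mem_univ _) hinj
  rw [Nat.card_Icc, Finset.card_univ] at this
  omega


/-- Apply `k` to `x`, evaluating `x` first. -/
def strictly {α : Type} (x : ℕ) (k : ℕ → α) : α :=
  match x with
  | 0 => k 0
  | n + 1 => k (n + 1)

theorem strictly_eq {α : Type} (x : ℕ) (k : ℕ → α) : strictly x k = k x := by
  cases x <;> rfl

/-- Subtraction of residues modulo `N`. -/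
def modSub (N a b : ℕ) : ℕ := (a + (N - b % N)) % N

theorem cast_mod_of_cast_eq_zero {R : Type*} [CommRing R] {N : ℕ} (hN : (N : R) = 0) (a : ℕ) :
    ((a % N : ℕ) : R) = a := by
  conv_rhs => rw [← Nat.mod_add_div a N]
  push_cast
  rw [hN, zero_mul, add_zero]

theorem cast_modSub {R : Type*} [CommRing R] {N : ℕ} (h0 : 0 < N) (hN : (N : R) = 0) (a b : ℕ) :
    ((modSub N a b : ℕ) : R) = a - b := by
  rw [modSub, cast_mod_of_cast_eq_zero hN, Nat.cast_add, Nat.cast_sub (Nat.mod_lt _ h0).le, hN,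
    cast_mod_of_cast_eq_zero hN]
  ring

/-- Doubling in Jacobian coordinates modulo `N`. -/
def jacDouble {α : Type} (N a X Y Z : ℕ) (k : ℕ → ℕ → ℕ → α) : α :=
  strictly (Y * Y % N) fun Y2 =>
  strictly (4 * X * Y2 % N) fun S =>
  strictly (Z * Z % N) fun Z2 =>
  strictly ((3 * X * X + a * (Z2 * Z2 % N)) % N) fun M =>
  strictly (modSub N (M * M) (2 * S)) fun X' =>
  strictly (modSub N (M * modSub N S X') (8 * Y2 * Y2)) fun Y' =>
  strictly (2 * Y * Z % N) fun Z' => k X' Y' Z'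

/-- Addition of the affine point `(x, y)` in Jacobian coordinates modulo `N`. -/
def jacAdd {α : Type} (N x y X Y Z : ℕ) (k : ℕ → ℕ → ℕ → α) : α :=
  strictly (Z * Z % N) fun Z2 =>
  strictly (modSub N (x * Z2) X) fun H =>
  strictly (modSub N (y * (Z2 * Z % N)) Y) fun R =>
  strictly (H * H % N) fun H2 =>
  strictly (H2 * H % N) fun H3 =>
  strictly (X * H2 % N) fun U =>
  strictly (modSub N (R * R) (H3 + 2 * U)) fun X' =>
  strictly (modSub N (R * modSub N U X') (Y * H3)) fun Y' =>
  strictly (Z * H % N) fun Z' => k X' Y' Z'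

/-- Left-to-right double-and-add through the lowest `n` bits of `K`. -/
def jacLadder (N a x y K : ℕ) (k : ℕ → ℕ → ℕ → Bool) : ℕ → ℕ → ℕ → ℕ → Bool
  | 0, X, Y, Z => k X Y Z
  | n + 1, X, Y, Z => jacDouble N a X Y Z fun X Y Z =>
      cond (Nat.beq ((K >>> n) % 2) 1) (jacAdd N x y X Y Z (jacLadder N a x y K k n))
        (jacLadder N a x y K k n X Y Z)

section
variable {N a x y : ℕ} (h0 : 0 < N) (hN : (N : F) = 0)
include h0 hN

theorem jacDouble_spec {b : F} {P : (shortCurve (a : F) b).Point} {X Y Z : ℕ}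
    (h : (Z : F) ≠ 0 → HasJacobian P X Y Z) {k : ℕ → ℕ → ℕ → Bool}
    (hk : jacDouble N a X Y Z k = true) :
    ∃ X' Y' Z' : ℕ, k X' Y' Z' = true ∧ ((Z' : F) ≠ 0 → HasJacobian (P + P) X' Y' Z') := by
  simp only [jacDouble, strictly_eq] at hk
  refine ⟨_, _, _, hk, fun hZ => ?_⟩
  simp only [cast_modSub h0 hN, cast_mod_of_cast_eq_zero hN, Nat.cast_mul, Nat.cast_add,
    Nat.cast_ofNat] at hZ ⊢
  convert (h fun h => hZ (by rw [h]; ring)).double hZ using 1 <;> ring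

theorem jacAdd_spec {b : F} {P : (shortCurve (a : F) b).Point} {X Y Z : ℕ}
    (h : (Z : F) ≠ 0 → HasJacobian P (X : F) Y Z)
    (h₀ : (shortCurve (a : F) b).Nonsingular (x : F) y)
    {k : ℕ → ℕ → ℕ → Bool} (hk : jacAdd N x y X Y Z k = true) :
    ∃ X' Y' Z' : ℕ, k X' Y' Z' = true ∧
      ((Z' : F) ≠ 0 → HasJacobian (P + Point.some _ _ h₀) (X' : F) Y' Z') := by
  simp only [jacAdd, strictly_eq] at hk
  refine ⟨_, _, _, hk, fun hZ => ?_⟩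
  simp only [cast_modSub h0 hN, cast_mod_of_cast_eq_zero hN, Nat.cast_mul, Nat.cast_add,
    Nat.cast_ofNat] at hZ ⊢
  have hZ' : (Z : F) * (x * (Z : F) ^ 2 - X) ≠ 0 := fun h => hZ (by rw [← h]; ring)
  convert (h fun h => hZ (by rw [h]; ring)).add_some h₀ hZ' using 1 <;> ring

theorem jacLadder_spec {b : F} (h₀ : (shortCurve (a : F) b).Nonsingular (x : F) y) {K : ℕ}
    {k : ℕ → ℕ → ℕ → Bool} (n : ℕ) {X Y Z : ℕ}
    (h : (Z : F) ≠ 0 → HasJacobian ((K >>> n) • Point.some _ _ h₀) (X : F) Y Z)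
    (hk : jacLadder N a x y K k n X Y Z = true) :
    ∃ X' Y' Z' : ℕ, k X' Y' Z' = true ∧
      ((Z' : F) ≠ 0 → HasJacobian (K • Point.some _ _ h₀) (X' : F) Y' Z') := by
  induction n generalizing X Y Z with
  | zero => exact ⟨X, Y, Z, hk, h⟩
  | succ n ih =>
    obtain ⟨X₁, Y₁, Z₁, hk₁, h₁⟩ := jacDouble_spec h0 hN h hk
    have hs : K >>> (n + 1) = K >>> n / 2 := Nat.shiftRight_succ K n
    rw [← add_nsmul] at h₁
    cases hb : Nat.beq ((K >>> n) % 2) 1 with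
    | true =>
      rw [hb, cond_true] at hk₁
      obtain ⟨X₂, Y₂, Z₂, hk₂, h₂⟩ := jacAdd_spec h0 hN h₁ h₀ hk₁
      have := Nat.eq_of_beq_eq_true hb
      refine ih ?_ hk₂
      rwa [← succ_nsmul, hs, show K >>> n / 2 + K >>> n / 2 + 1 = K >>> n by omega] at h₂
    | false =>
      rw [hb, cond_false] at hk₁
      have := Nat.ne_of_beq_eq_false hb
      refine ih ?_ hk₁
      rwa [hs, show K >>> n / 2 + K >>> n / 2 = K >>> n by omega] at h₁

end

/-- The multiple `K • (x, y)`, in Jacobian coordinates modulo `N`, satisfies the test `k`. -/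
def jacMul (N a x y K : ℕ) (k : ℕ → ℕ → ℕ → Bool) : Bool :=
  Nat.beq (K >>> Nat.log2 K) 1 && jacLadder N a x y K k (Nat.log2 K) x y 1

/-- The numerical part of an elliptic curve primality certificate: on the curve
`y² = x³ + a x + b` modulo `N` through `(x, y)`, the point `f • (x, y)` is of order `s`. -/
def ecppCheck (N a x y f s : ℕ) : Bool :=
  Nat.ble 2 N && Nat.beq (Nat.gcd (2 * y) N) 1 && Nat.ble (4 * N + 1) ((s - 1) * (s - 1)) &&
  Nat.beq (s % 2) 1 &&
  jacMul N a x y f (fun _ _ Z => Nat.beq (Nat.gcd Z N) 1) &&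
  jacMul N a x y (f * s - 1) (fun X Y Z => Nat.beq (Nat.gcd Z N) 1 &&
    Nat.beq ((x * (Z * Z)) % N) (X % N) && Nat.beq ((y * (Z * (Z * Z)) + Y) % N) 0)

theorem prime_of_ecppCheck {N a x y f s : ℕ} (hs : s.Prime)
    (h : ecppCheck N a x y f s = true) : N.Prime := by
  simp only [ecppCheck, jacMul, Bool.and_eq_true, Nat.beq_eq, Nat.ble_eq] at h
  obtain ⟨⟨⟨⟨⟨hN2, hy⟩, hsN⟩, hsodd⟩, hf1, hf⟩, hm1, hm⟩ := h
  by_contra hNp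
  have hN0 : 0 < N := by omega
  set r := N.minFac with hr
  have hrp : r.Prime := Nat.minFac_prime (by omega)
  have hrN : r ∣ N := Nat.minFac_dvd N
  have hr2 : r ^ 2 ≤ N := Nat.minFac_sq_le_self hN0 hNp
  have : Fact r.Prime := ⟨hrp⟩
  have hN : (N : ZMod r) = 0 := (ZMod.natCast_eq_zero_iff _ _).mpr hrN
  have hunit : ∀ z : ℕ, Nat.gcd z N = 1 → (z : ZMod r) ≠ 0 := by
    intro z hz h
    rw [ZMod.natCast_eq_zero_iff] at h
    exact hrp.one_lt.ne' (Nat.dvd_one.mp (hz ▸ Nat.dvd_gcd h hrN))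
  have hy' := hunit _ hy
  set b : ZMod r := y ^ 2 - x ^ 3 - a * x with hb
  have h₀ : (shortCurve (a : ZMod r) b).Nonsingular (x : ZMod r) y := by
    rw [WeierstrassCurve.Affine.nonsingular_iff, WeierstrassCurve.Affine.equation_iff]
    refine ⟨by simp only [hb]; ring, Or.inr ?_⟩
    intro h
    apply hy'
    push_cast
    linear_combination h
  have hone : ((1 : ℕ) : ZMod r) ≠ 0 → HasJacobian (1 • Point.some _ _ h₀)
      ((x : ℕ) : ZMod r) ((y : ℕ) : ZMod r) ((1 : ℕ) : ZMod r) :=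
    fun _ => ⟨_, _, h₀, one_nsmul _, by simp, by simp⟩
  obtain ⟨X, Y, Z, hZ, hQ⟩ := jacLadder_spec hN0 hN h₀ (K := f) f.log2
    (by rw [hf1]; exact hone) hf
  rw [Nat.beq_eq] at hZ
  obtain ⟨xQ, yQ, hxyQ, hQ, -⟩ := hQ (hunit _ hZ)
  obtain ⟨X', Y', Z', hZ', hR⟩ := jacLadder_spec hN0 hN h₀ (K := f * s - 1) (f * s - 1).log2
    (by rw [hm1]; exact hone) hm
  simp only [Bool.and_eq_true, Nat.beq_eq] at hZ'
  obtain ⟨⟨hZ', hX'⟩, hY'⟩ := hZ'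
  obtain ⟨xR, yR, hxyR, hR, hXR, hYR⟩ := hR (hunit _ hZ')
  have hz := hunit _ hZ'
  have hx : xR = x := by
    have := congrArg (Nat.cast (R := ZMod r)) hX'
    rw [cast_mod_of_cast_eq_zero hN, cast_mod_of_cast_eq_zero hN, hXR] at this
    push_cast at this
    have h2 : (Z' : ZMod r) ^ 2 ≠ 0 := pow_ne_zero _ hz
    exact mul_right_cancel₀ h2 (by linear_combination -this)
  have hyR : yR = -y := by
    have := congrArg (Nat.cast (R := ZMod r)) hY'
    rw [cast_mod_of_cast_eq_zero hN] at this
    push_cast at this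
    rw [hYR] at this
    have h2 : (Z' : ZMod r) ^ 3 ≠ 0 := pow_ne_zero _ hz
    exact mul_right_cancel₀ h2 (by linear_combination this)
  have hfs : 1 ≤ f * s := by
    rcases Nat.eq_zero_or_pos (f * s) with h | h
    · rw [h] at hm1
      simp at hm1
    · exact h
  have hzero : (f * s) • Point.some _ _ h₀ = 0 := by
    rw [← Nat.sub_add_cancel hfs, succ_nsmul, hR]
    exact Point.add_of_Y_eq hx (by rw [hyR]; simp [WeierstrassCurve.Affine.negY])
  have hord : addOrderOf (f • Point.some _ _ h₀) = s := by
    have : Fact s.Prime := ⟨hs⟩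
    apply addOrderOf_eq_prime
    · rw [← mul_nsmul, hzero]
    · rw [hQ]
      exact Point.some_ne_zero _
  have hle := addOrderOf_point_le _ (hord.symm ▸ Nat.odd_iff.mpr hsodd)
  rw [hord, ZMod.card] at hle
  have h1 : (s - 1) * (s - 1) ≤ 2 * r * (2 * r) := Nat.mul_le_mul (by omega) (by omega)
  have h2 : 2 * r * (2 * r) = 4 * r ^ 2 := by ring
  omega

end EllipticCurvePrimality

theorem prime_certificate : Nat.Prime
    16945040294508643626766970344671736711372714199692361133819650471429117238727860668101966963109431360020829041883604581979861972343779171429535925643664019506297202379583729176661459985641091428470465136529409 := by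
  have h0 : Nat.Prime 609313 := by norm_num
  have h1 : Nat.Prime
      3956200141 :=
    prime_of_ecppCheck (a := 0)
      (x := 2812014929)
      (y := 2945401441)
      (f := 6493) h0 (by decide +kernel)
  have h2 : Nat.Prime
      27847851363956513 :=
    prime_of_ecppCheck (a := 20256271470319110)
      (x := 26737038273933291)
      (y := 9120714151559417)
      (f := 7039040) h1 (by decide +kernel)
  have h3 : Nat.Prime
      181928084936581903473875049357353 :=
    prime_of_ecppCheck (a := 52209465600468353329985615483868)
      (x := 78808081687939791734341657945885)
      (y := 40182996893650109191763039007937)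
      (f := 6532930765784376) h2 (by decide +kernel)
  have h4 : Nat.Prime
      1168450401839706572324658024088633869749184673725881128126433 :=
    prime_of_ecppCheck (a := 297301627466870686727913806014703557430803950677262264907164)
      (x := 1087428301189295657834178782350957718351713837111946287916595)
      (y := 129611859980420391101457242664062115479421213243881469655578)
      (f := 6422594962438126689459535586) h3 (by decide +kernel)
  have h5 : Nat.Prime
      36219273703428168252064882297422435135782318816205595190982328299389861871522962269 :=
    prime_of_ecppCheck (a := 12105486653793389152696972858936065473059167827450987431773833539823278487486984990)
      (x := 11108709727799870444127771008596967883155414305811200289368603569158193660626534109)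
      (y := 12581498269853702770316734572876295555706584757748561981853034921183991077007594141)
      (f := 30997698872285462788819) h4 (by decide +kernel)
  have h6 : Nat.Prime
      310098502858939888525434591255243273260117051038753338553031731636815950280861692167601204483581 :=
    prime_of_ecppCheck (a := 162365859155884421854688622216897500325364841622623161214486243494947595761089795966714845914495)
      (x := 57611182724035230988816666316659787675939962176735932509154451922192901392339715887761135003031)
      (y := 241969749975372292815705439155997322943308748257695703039029387162076771509316258422167916703848)
      (f := 8561698542000) h5 (by decide +kernel)
  have h7 : Nat.Prime
      39324439429731452371772984765730488048467399760589511161828832274682063573296645809178093560605637716356816504739181 :=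
    prime_of_ecppCheck (a := 254837695475956431071348556319028713396960176507093568331301336548718603021228401920641578714788697076642468172228)
      (x := 31300981137001624662691266820010888601965253873605368342059865414216799960160885510239618796119623598965866781192163)
      (y := 12421432504141162316130624103462661385928487091702202756550848576895666420504714823274953013268652797482878523673603)
      (f := 126812735524942766271) h6 (by decide +kernel)
  have h8 : Nat.Prime
      75153812509767940945028337746314085854789453497601640585015351078743720829881488088050542897735646433451691786043077030417970097352078482750683 :=
    prime_of_ecppCheck (a := 0)
      (x := 67323177740576830642921110019390764610166526452606068442275157645849608851491181988129425728581290536791907730522334622066723098848393553855282)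
      (y := 57592004994015409361417591083680162750096062324393120346856456820252185296311844690764220515491956204013058588173394525831160488324432655730147)
      (f := 1911122284249206608505118564) h7 (by decide +kernel)
  have h9 : Nat.Prime
      2229485782836413601576631399907733309806450421229952843686680697216989093523986136067913789441618324387885457055904052045358397281046753775923788594922227822896787427778473829372081 :=
    prime_of_ecppCheck (a := 0)
      (x := 1045339961327275677012297035211577205275855884523910488477032970163023373676468012119640523069321026896648140171764750603492227269725527209504401245424617038007144552681624819200202)
      (y := 1761002126040992735986951005916311545238618865968466493545598544221000639875193137697993527985633695615175571317390226459651765787496998864946358618208886269547599431079425214113180)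
      (f := 29665637821722502810319129145445575325) h8 (by decide +kernel)
  have h10 : Nat.Prime
      16945040294508643626766970344671736711372714199692361133819650471429117238727860668101966963109431360020829041883604581979861972343779171429535925643664019506297202379583729176661459985641091428470465136529409 :=
    prime_of_ecppCheck (a := 854239128456389880771341397892355907885834132463640266249444708913682165091612462449680126658583789380192112268749735945016405339094844171076998853390574599604572343734090205916259115273083803392073964190241)
      (x := 4630836419373360676825047320262286070920286065278862492706698844501583839078348548263539516986960421498480180614793533269928815687929354894411078587082517506911813427553492452880371648358839118965729403923043)
      (y := 14018141922637583785909383957342731108331530733351453237127494450184609129700433730751380234012537039775399493499163176189687620308887031099206039305613848735438597316736555837407866460664058665563205707901242)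
      (f := 7600425364879740898842620836) h9 (by decide +kernel)
  exact h10

section Eigenfunctionals

open Polynomial

variable {V : Type*} [AddCommGroup V] (T : Module.End ℤ V)

theorem map_aeval_apply_of_eigen {A : Type*} [AddCommGroup A] {ψ : V →+ A} {c : ℤ}
    (hψ : ∀ v, ψ (T v) = c • ψ v) (r : ℤ[X]) (v : V) :
    ψ (aeval T r v) = r.eval c • ψ v := by
  induction r using Polynomial.induction_on' with
  | add p q hp hq => simp [hp, hq, add_smul]
  | monomial n m =>
    have hn : ∀ n : ℕ, ψ ((T ^ n) v) = c ^ n • ψ v := by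
      intro n
      induction n with
      | zero => simp
      | succ n ih => rw [pow_succ', Module.End.mul_apply, hψ, ih, smul_smul, pow_succ']
    rw [aeval_monomial, eval_monomial, Module.End.mul_apply, Module.algebraMap_end_apply,
      map_zsmul, hn, smul_smul]

theorem map_sub_pow_apply_of_eigen {A : Type*} [AddCommGroup A] {ψ : V →+ A} {c : ℤ}
    (hψ : ∀ v, ψ (T v) = c • ψ v) {p : ℤ} {v : V} (hp : p • ψ v = 0) {n : ℕ}
    (hn : p ∣ c ^ n + 1) : ψ (v - (T ^ n) v) = (2 : ℤ) • ψ v := by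
  have h := map_aeval_apply_of_eigen T hψ (1 - X ^ n) v
  obtain ⟨m, hm⟩ := hn
  have h1 : 1 - c ^ n = 2 - m * p := by linear_combination -hm
  simp only [map_sub, map_one, map_pow, aeval_X, eval_sub, eval_one, eval_pow, eval_X, h1,
    LinearMap.sub_apply, Module.End.one_apply] at h
  rw [map_sub, h, sub_smul, mul_smul, hp, smul_zero, sub_zero]

/-- If a relation between `v` and `w` over `ℤ[X]/(Φ)` is nonzero at a `p`-adic root `α` of `Φ`,
then there is one that is nonzero modulo `p` at the residue of `α`. -/
theorem exists_relation_not_dvd {p : ℕ} [Fact p.Prime] (hV : ∀ v : V, (p : ℤ) • v = 0 → v = 0)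
    {Φ : ℤ[X]} {a : ℤ} {α : ℤ_[p]} (hα : aeval α Φ = 0) (hαa : (p : ℤ_[p]) ∣ α - a)
    (hΦ' : ¬ (p : ℤ) ∣ (derivative Φ).eval a) {v w : V} (hv : aeval T Φ v = 0)
    (hw : aeval T Φ w = 0) (k : ℕ) {r s : ℤ[X]} (hrs : aeval T r v + aeval T s w = 0)
    (hk : ¬ ((p : ℤ_[p]) ^ k ∣ aeval α r ∧ (p : ℤ_[p]) ^ k ∣ aeval α s)) :
    ∃ r s : ℤ[X], aeval T r v + aeval T s w = 0 ∧
      ¬ ((p : ℤ) ∣ r.eval a ∧ (p : ℤ) ∣ s.eval a) := by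
  have hp0 : (p : ℤ_[p]) ≠ 0 := by exact_mod_cast (Fact.out : p.Prime).ne_zero
  have hdvd : ∀ f : ℤ[X], (p : ℤ_[p]) ∣ aeval α f ↔ (p : ℤ) ∣ f.eval a := by
    intro f
    have h1 : (p : ℤ_[p]) ∣ aeval α f - ((f.eval a : ℤ) : ℤ_[p]) := by
      have h2 : ((f.eval a : ℤ) : ℤ_[p]) = aeval (a : ℤ_[p]) f := by
        rw [← eq_intCast (algebraMap ℤ ℤ_[p]), ← aeval_algebraMap_apply_eq_algebraMap_eval]
        simp
      rw [h2, aeval_def, aeval_def, ← eval_map, ← eval_map]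
      exact hαa.trans (sub_dvd_eval_sub _ _ _)
    rw [dvd_iff_dvd_of_dvd_sub h1, ← PadicInt.norm_int_lt_one_iff_dvd,
      ← PadicInt.norm_lt_one_iff_dvd]
  obtain ⟨t, ht⟩ : ∃ t : ℤ[X], Φ - C (Φ.eval a) = (X - C a) * t := X_sub_C_dvd_sub_C_eval
  have hΦa : (p : ℤ) ∣ Φ.eval a := (hdvd Φ).mp (hα ▸ dvd_zero _)
  obtain ⟨m, hm⟩ := hΦa
  have hta : ¬ (p : ℤ_[p]) ∣ aeval α t := by
    rw [hdvd]
    have := congrArg (fun f => (derivative f).eval a) ht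
    simp only [derivative_sub, derivative_C, sub_zero, derivative_mul, derivative_X, eval_add,
      eval_mul, eval_sub, eval_X, eval_C, sub_self, zero_mul, add_zero, one_mul] at this
    rwa [← this]
  have hprime : Prime (p : ℤ_[p]) := PadicInt.prime_p
  -- dividing a relation by `p`
  have key : ∀ f : ℤ[X], (p : ℤ) ∣ f.eval a → ∃ f₁ f₂ : ℤ[X],
      t * f = Φ * f₁ + C (p : ℤ) * f₂ := by
    rintro f ⟨n, hn⟩
    obtain ⟨g, hg⟩ : ∃ g : ℤ[X], f - C (f.eval a) = (X - C a) * g := X_sub_C_dvd_sub_C_eval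
    refine ⟨g, C n * t - C m * g, ?_⟩
    rw [hm, C_mul] at ht
    rw [hn, C_mul] at hg
    linear_combination t * hg - g * ht
  induction k generalizing r s with
  | zero => exact absurd ⟨by simp, by simp⟩ hk
  | succ k ih =>
    by_cases h : (p : ℤ) ∣ r.eval a ∧ (p : ℤ) ∣ s.eval a
    · obtain ⟨r₁, r₂, hr⟩ := key r h.1
      obtain ⟨s₁, s₂, hs⟩ := key s h.2
      have hmul : ∀ (f g : ℤ[X]) (x : V), aeval T (f * g) x = aeval T f (aeval T g x) := by
        intro f g x
        rw [map_mul, Module.End.mul_apply]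
      refine ih (r := r₂) (s := s₂) (hV _ ?_) ?_
      · have e1 : ∀ (f f₁ f₂ : ℤ[X]) (x : V), t * f = Φ * f₁ + C (p : ℤ) * f₂ →
            aeval T Φ x = 0 → aeval T t (aeval T f x) = (p : ℤ) • aeval T f₂ x := by
          intro f f₁ f₂ x hf hx
          rw [← hmul, hf, mul_comm Φ, map_add, LinearMap.add_apply, hmul, hx, map_zero, zero_add,
            hmul, aeval_C, Module.algebraMap_end_apply]
        rw [smul_add, ← e1 r r₁ r₂ v hr hv, ← e1 s s₁ s₂ w hs hw, ← map_add, hrs, map_zero]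
      · rintro ⟨h1, h2⟩
        have e2 : ∀ f f₁ f₂ : ℤ[X], t * f = Φ * f₁ + C (p : ℤ) * f₂ →
            (p : ℤ_[p]) ^ k ∣ aeval α f₂ → (p : ℤ_[p]) ^ (k + 1) ∣ aeval α f := by
          intro f f₁ f₂ hf h
          have := congrArg (aeval α) hf
          rw [map_mul, map_add, map_mul, hα, zero_mul, zero_add, map_mul, aeval_C] at this
          refine (hprime.pow_dvd_of_dvd_mul_left _ hta ?_)
          rw [this, pow_succ']
          exact mul_dvd_mul (by simp) h
        exact hk ⟨e2 r r₁ r₂ hr h1, e2 s s₁ s₂ hs h2⟩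
    · exact ⟨r, s, hrs, h⟩

theorem eq_zero_of_zsmul_eq_zero_of_not_dvd {p : ℕ} (hp : p.Prime) {A : Type*} [AddCommGroup A]
    {n : ℤ} {x : A} (hA : (p : ℤ) • x = 0) (hn : ¬ (p : ℤ) ∣ n) (hx : n • x = 0) :
    x = 0 := by
  obtain ⟨b, d, hbd⟩ : IsCoprime n (p : ℤ) :=
    ((Nat.prime_iff_prime_int.mp hp).coprime_iff_not_dvd.mpr hn).symm
  rw [← one_smul ℤ x, ← hbd, add_smul, mul_smul, mul_smul, hx, hA, smul_zero, smul_zero,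
    add_zero]

theorem eigenfunctional_eq_zero {p : ℕ} [Fact p.Prime]
    (hV : ∀ v : V, (p : ℤ) • v = 0 → v = 0) {Φ : ℤ[X]} (hm : Φ.Monic) (hi : Irreducible Φ)
    {a : ℤ} (ha : (p : ℤ) ∣ Φ.eval a) (hΦ' : ¬ (p : ℤ) ∣ (derivative Φ).eval a)
    (hrank : ∀ f : Fin Φ.natDegree ⊕ Fin Φ.natDegree → V, ¬ LinearIndependent ℤ f)
    {v w : V} (hv : aeval T Φ v = 0) (hw : aeval T Φ w = 0)
    {A B : Type*} [AddCommGroup A] [AddCommGroup B] {ψ : V →+ A} {φ : V →+ B}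
    (hA : ∀ v, (p : ℤ) • ψ v = 0) (hB : ∀ v, (p : ℤ) • φ v = 0)
    (hψ : ∀ v, ψ (T v) = a • ψ v) (hφ : ∀ v, φ (T v) = a • φ v)
    (hψw : ψ w = 0) (hφw : φ w ≠ 0) : ψ v = 0 := by
  have hcast : ∀ f : ℤ[X], aeval (a : ℤ_[p]) f = ((f.eval a : ℤ) : ℤ_[p]) := by
    intro f
    have := aeval_algebraMap_apply_eq_algebraMap_eval (A := ℤ_[p]) a f
    simpa using this
  have hder : ‖aeval (a : ℤ_[p]) (derivative Φ)‖ = 1 := by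
    rw [hcast]
    refine le_antisymm (PadicInt.norm_le_one _) (not_lt.mp ?_)
    rwa [PadicInt.norm_int_lt_one_iff_dvd]
  obtain ⟨α, hα, hαa, -, -⟩ := hensels_lemma (F := Φ) (a := (a : ℤ_[p])) (by
    rw [hder, one_pow, hcast, PadicInt.norm_int_lt_one_iff_dvd]
    exact ha)
  rw [hder, PadicInt.norm_lt_one_iff_dvd] at hαa
  have hne : ∀ f : ℤ[X], f ≠ 0 → f.degree < Φ.natDegree → aeval α f ≠ 0 := by
    intro f hf0 hfd hf
    have hroot : ∀ g : ℤ[X], aeval α g = 0 → aeval (α : ℚ_[p]) (g.map (algebraMap ℤ ℚ)) = 0 := by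
      intro g hg
      rw [aeval_map_algebraMap]
      have := aeval_algebraMap_apply ℚ_[p] α g
      rw [hg, map_zero] at this
      exact this
    have hmin : Φ.map (algebraMap ℤ ℚ) = minpoly ℚ (α : ℚ_[p]) :=
      minpoly.eq_of_irreducible_of_monic
        ((hm.irreducible_iff_irreducible_map_fraction_map).mp hi) (hroot Φ hα) (hm.map _)
    have h1 := minpoly.degree_le_of_ne_zero ℚ (α : ℚ_[p])
      ((Polynomial.map_ne_zero_iff (algebraMap ℤ ℚ).injective_int).mpr hf0) (hroot f hf)
    rw [← hmin, degree_map_eq_of_injective (algebraMap ℤ ℚ).injective_int,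
      degree_map_eq_of_injective (algebraMap ℤ ℚ).injective_int, degree_eq_natDegree hm.ne_zero]
      at h1
    exact absurd hfd (not_lt.mpr h1)
  obtain ⟨g, hg, j, hj⟩ := Fintype.not_linearIndependent_iff.mp
    (hrank (Sum.elim (fun i => (T ^ (i : ℕ)) v) (fun i => (T ^ (i : ℕ)) w)))
  let P : (Fin Φ.natDegree → ℤ) → ℤ[X] := fun c => ∑ i, C (c i) * X ^ (i : ℕ)
  have hPT : ∀ c x, aeval T (P c) x = ∑ i, c i • (T ^ (i : ℕ)) x := by
    intro c x
    simp [P, LinearMap.sum_apply]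
  have hPcoeff : ∀ c (i : Fin Φ.natDegree), (P c).coeff i = c i := by
    intro c i
    simp [P, coeff_X_pow, Fin.val_inj]
  have hPne : ∀ c (i : Fin Φ.natDegree), c i ≠ 0 → aeval α (P c) ≠ 0 := by
    intro c i hi
    refine hne _ ?_ (degree_sum_fin_lt c)
    intro h
    exact hi (by rw [← hPcoeff c i, h, coeff_zero])
  have hex : ∃ k : ℕ, ¬ ((p : ℤ_[p]) ^ k ∣ aeval α (P (g ∘ Sum.inl)) ∧
      (p : ℤ_[p]) ^ k ∣ aeval α (P (g ∘ Sum.inr))) := by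
    have hfin : ∀ x : ℤ_[p], x ≠ 0 → ∃ k : ℕ, ¬ (p : ℤ_[p]) ^ k ∣ x := by
      intro x hx
      obtain ⟨k, hk⟩ := FiniteMultiplicity.of_not_isUnit PadicInt.prime_p.not_isUnit hx
      exact ⟨_, hk⟩
    rcases j with i | i
    · obtain ⟨k, hk⟩ := hfin _ (hPne (g ∘ Sum.inl) i hj)
      exact ⟨k, fun h => hk h.1⟩
    · obtain ⟨k, hk⟩ := hfin _ (hPne (g ∘ Sum.inr) i hj)
      exact ⟨k, fun h => hk h.2⟩
  obtain ⟨k, hk⟩ := hex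
  obtain ⟨r, s, hrs, hrs'⟩ := exists_relation_not_dvd T hV hα hαa hΦ' hv hw k (by
    rw [hPT, hPT]
    simpa [Fintype.sum_sum_type] using hg) hk
  have hψrs := congrArg ψ hrs
  have hφrs := congrArg φ hrs
  simp only [map_add, map_zero, map_aeval_apply_of_eigen T hψ, map_aeval_apply_of_eigen T hφ,
    hψw, smul_zero, add_zero] at hψrs hφrs
  by_cases hr : (p : ℤ) ∣ r.eval a
  · obtain ⟨m, hm⟩ := id hr
    rw [hm, mul_comm, mul_smul, hB, smul_zero, zero_add] at hφrs
    exact absurd (eq_zero_of_zsmul_eq_zero_of_not_dvd Fact.out (hB w) (fun hs => hrs' ⟨hr, hs⟩) hφrs)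
      hφw
  · exact eq_zero_of_zsmul_eq_zero_of_not_dvd Fact.out (hA v) hr hψrs

end Eigenfunctionals

section UnitCharacters

open Polynomial NumberField

theorem units_eq_one_of_pow_prime_eq_one {K : Type*} [Field K] [NumberField K] {p : ℕ}
    (hp : p.Prime) (hK : Module.finrank ℚ K < p - 1) {v : (𝓞 K)ˣ} (hv : v ^ p = 1) : v = 1 := by
  by_contra hne
  have : Fact p.Prime := ⟨hp⟩
  have hprim : IsPrimitiveRoot v p := by
    rw [← orderOf_eq_prime hv hne]
    exact IsPrimitiveRoot.orderOf v
  have hprim' : IsPrimitiveRoot ((v : 𝓞 K) : K) p :=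
    (IsPrimitiveRoot.coe_units_iff.mpr hprim).map_of_injective RingOfIntegers.coe_injective
  have h1 := minpoly.natDegree_le (A := ℚ) ((v : 𝓞 K) : K)
  rw [← cyclotomic_eq_minpoly_rat hprim' hp.pos, natDegree_cyclotomic, Nat.totient_prime hp] at h1
  omega

theorem unit_character_eq_one {K : Type*} [Field K] [NumberField K] {p k : ℕ} (hp : p.Prime)
    (hp2 : p ≠ 2) (hKp : Module.finrank ℚ K < p - 1) (hK : Module.finrank ℚ K ≤ 2 ^ (k + 1))
    {T : 𝓞 K →+* 𝓞 K} (hT : ∀ x, T^[2 ^ (k + 1)] x = x) {a : ℕ} (ha : p ∣ a ^ 2 ^ k + 1)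
    {A B : Type*} [CommGroup A] [CommGroup B] {ψ : (𝓞 K)ˣ →* A} {φ : (𝓞 K)ˣ →* B}
    (hA : ∀ v, ψ v ^ p = 1) (hB : ∀ v, φ v ^ p = 1)
    (hψ : ∀ v, ψ (Units.map T v) = ψ v ^ a) (hφ : ∀ v, φ (Units.map T v) = φ v ^ a)
    {η : (𝓞 K)ˣ} (hη : ψ η = 1) (hη' : φ η ≠ 1) (ε : (𝓞 K)ˣ) : ψ ε = 1 := by
  have : Fact p.Prime := ⟨hp⟩
  let τ : Module.End ℤ (Additive (𝓞 K)ˣ) :=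
    (MonoidHom.toAdditive (Units.map (T : 𝓞 K →* 𝓞 K))).toIntLinearMap
  let f : Additive (𝓞 K)ˣ →+ Additive A := MonoidHom.toAdditive ψ
  let g : Additive (𝓞 K)ˣ →+ Additive B := MonoidHom.toAdditive φ
  have hτ : ∀ v, (τ ^ 2 ^ (k + 1)) v = v := by
    intro v
    have h1 : ∀ (n : ℕ) (v : Additive (𝓞 K)ˣ),
        (((τ ^ n) v).toMul : 𝓞 K) = T^[n] (v.toMul : 𝓞 K) := by
      intro n
      induction n with
      | zero => simp
      | succ n ih =>
        intro v
        rw [pow_succ, Module.End.mul_apply, ih, Function.iterate_succ_apply]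
        rfl
    apply Additive.toMul.injective
    apply Units.ext
    rw [h1, hT]
  have hf : ∀ v, f (τ v) = (a : ℤ) • f v := by
    intro v
    rw [natCast_zsmul]
    exact congrArg Additive.ofMul (hψ v.toMul)
  have hg : ∀ v, g (τ v) = (a : ℤ) • g v := by
    intro v
    rw [natCast_zsmul]
    exact congrArg Additive.ofMul (hφ v.toMul)
  have hfp : ∀ v, (p : ℤ) • f v = 0 := by
    intro v
    rw [natCast_zsmul]
    exact congrArg Additive.ofMul (hA v.toMul)
  have hgp : ∀ v, (p : ℤ) • g v = 0 := by
    intro v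
    rw [natCast_zsmul]
    exact congrArg Additive.ofMul (hB v.toMul)
  have hΦ : cyclotomic (2 ^ (k + 1)) ℤ = X ^ 2 ^ k + 1 := by
    rw [cyclotomic_prime_pow_eq_geom_sum Nat.prime_two]
    simp [Finset.sum_range_succ, add_comm]
  have hdeg : (cyclotomic (2 ^ (k + 1)) ℤ).natDegree = 2 ^ k := by
    rw [natDegree_cyclotomic, Nat.totient_prime_pow_succ Nat.prime_two]
    simp
  have hpa : (p : ℤ) ∣ (a : ℤ) ^ 2 ^ k + 1 := by exact_mod_cast ha
  have hp2' : ¬ (p : ℤ) ∣ 2 := by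
    intro h
    exact hp2 ((Nat.prime_dvd_prime_iff_eq hp Nat.prime_two).mp (by exact_mod_cast h))
  have hpr : Prime (p : ℤ) := Nat.prime_iff_prime_int.mp hp
  -- the two relevant elements killed by `τ ^ 2 ^ k + 1`
  have hker : ∀ v, aeval τ (cyclotomic (2 ^ (k + 1)) ℤ) (v - (τ ^ 2 ^ k) v) = 0 := by
    intro v
    have h2 : (τ ^ 2 ^ k) ((τ ^ 2 ^ k) v) = v := by
      rw [← Module.End.mul_apply, ← pow_add, ← two_mul, ← pow_succ', hτ]
    rw [hΦ]
    simp [h2]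
  refine Additive.ofMul.injective ?_
  have h := eigenfunctional_eq_zero τ (p := p) (Φ := cyclotomic (2 ^ (k + 1)) ℤ) (a := a)
    (v := Additive.ofMul ε - (τ ^ 2 ^ k) (Additive.ofMul ε))
    (w := Additive.ofMul η - (τ ^ 2 ^ k) (Additive.ofMul η))
    ?_ (cyclotomic.monic _ _) (cyclotomic.irreducible (by positivity)) ?_ ?_ ?_ (hker _) (hker _)
    hfp hgp hf hg ?_ ?_
  · rw [map_sub_pow_apply_of_eigen τ hf (hfp _) hpa] at h
    exact eq_zero_of_zsmul_eq_zero_of_not_dvd hp (hfp _) hp2' h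
  · intro v hv
    rw [natCast_zsmul] at hv
    exact congrArg Additive.ofMul (units_eq_one_of_pow_prime_eq_one hp hKp (v := v.toMul)
      (congrArg Additive.toMul hv))
  · rw [hΦ]
    simpa using hpa
  · have hp_a : ¬ (p : ℤ) ∣ a := by
      intro h'
      have := (Int.dvd_add_right (dvd_pow h' (pow_ne_zero k two_ne_zero))).mp hpa
      exact hpr.not_isUnit (isUnit_of_dvd_one this)
    rw [hΦ]
    simp only [derivative_add, derivative_one, add_zero, derivative_X_pow, eval_mul, eval_pow,
      eval_X, eval_C]
    intro h'
    rcases hpr.dvd_or_dvd h' with h' | h'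
    · exact hp2' (hpr.dvd_of_dvd_pow (n := k) (by exact_mod_cast h'))
    · exact hp_a (hpr.dvd_of_dvd_pow h')
  · intro F hF
    have h1 := hF.fintype_card_le_finrank
    rw [Units.finrank_eq, Units.rank, Fintype.card_sum, Fintype.card_fin, hdeg] at h1
    have h2 := InfinitePlace.card_add_two_mul_card_eq_rank K
    have h3 := InfinitePlace.card_eq_nrRealPlaces_add_nrComplexPlaces K
    have h4 : 0 < 2 ^ k := by positivity
    rw [pow_succ] at hK
    omega
  · rw [map_sub_pow_apply_of_eigen τ hf (hfp _) hpa]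
    have : f (Additive.ofMul η) = 0 := congrArg Additive.ofMul hη
    rw [this, smul_zero]
  · rw [map_sub_pow_apply_of_eigen τ hg (hgp _) hpa]
    intro h'
    exact hη' (congrArg Additive.toMul (eq_zero_of_zsmul_eq_zero_of_not_dvd hp (hgp _) hp2' h'))

end UnitCharacters

section RealCyclotomic

open NumberField Polynomial

theorem exists_conjugation_sums {K M : Type*} [Field K] [NumberField K] [Field M] [NumberField M]
    [Algebra K M] {n g : ℕ} [NeZero n] (hg : g.Coprime n) [IsCyclotomicExtension {n} ℚ M] {ζ : M}
    (hζ : IsPrimitiveRoot ζ n) {ω : K} (hω : algebraMap K M ω = ζ + ζ ^ (n - 1)) :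
    ∃ (T : K ≃ₐ[ℚ] K) (w : ℕ → 𝓞 K),
      (∀ d, RingOfIntegers.mapRingHom (T : K →+* K) (w d) = w (g * d)) ∧
      ∀ (R : Type) [CommRing R] (z : R), (cyclotomic n R).eval z = 0 →
        ∃ ρ : 𝓞 K →+* R, ∀ d, ρ (w d) = z ^ d + z ^ ((n - 1) * d) := by
  have hinv : ζ * ζ ^ (n - 1) = 1 := by
    rw [← pow_succ', Nat.sub_add_cancel NeZero.one_le, hζ.pow_eq_one]
  have hw : ∀ d : ℕ, ∃ x : 𝓞 K, algebraMap K M x = ζ ^ d + ζ ^ ((n - 1) * d) := by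
    intro d
    have hK : ∀ d : ℕ, ζ ^ d + ζ ^ ((n - 1) * d) ∈ (algebraMap K M).fieldRange ∧
        ζ ^ (d + 1) + ζ ^ ((n - 1) * (d + 1)) ∈ (algebraMap K M).fieldRange := by
      intro d
      have hmem : ζ + ζ ^ (n - 1) ∈ (algebraMap K M).fieldRange := ⟨ω, hω⟩
      induction d with
      | zero => exact ⟨⟨2, by rw [map_ofNat]; norm_num⟩, by simpa using hmem⟩
      | succ d ih =>
        refine ⟨ih.2, ?_⟩
        convert sub_mem (mul_mem hmem ih.2) ih.1 using 1
        simp only [pow_mul]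
        linear_combination (-(ζ ^ d) - (ζ ^ (n - 1)) ^ d) * hinv
    obtain ⟨x, hx⟩ := (hK d).1
    have hint : IsIntegral ℤ x := by
      rw [← isIntegral_algebraMap_iff (algebraMap K M).injective, hx]
      have := hζ.isIntegral (NeZero.pos n)
      exact (this.pow _).add (this.pow _)
    exact ⟨⟨x, hint⟩, hx⟩
  choose w hw using hw
  have : IsAbelianGalois ℚ M := IsCyclotomicExtension.isAbelianGalois {n} ℚ M
  have : IsAbelianGalois ℚ K := IsAbelianGalois.tower_bot ℚ K M
  have hζg := hζ.pow_of_coprime g hg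
  have hmin : aeval (ζ ^ g) (minpoly ℚ (hζ.powerBasis ℚ).gen) = 0 := by
    rw [hζ.powerBasis_gen ℚ, ← cyclotomic_eq_minpoly_rat hζ (NeZero.pos n),
      cyclotomic_eq_minpoly_rat hζg (NeZero.pos n), minpoly.aeval]
  let σ : M →ₐ[ℚ] M := (hζ.powerBasis ℚ).lift (ζ ^ g) hmin
  have hσ : σ ζ = ζ ^ g := by
    have := (hζ.powerBasis ℚ).lift_gen (ζ ^ g) hmin
    rwa [hζ.powerBasis_gen ℚ] at this
  refine ⟨σ.restrictNormal' K, w, ?_, ?_⟩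
  · intro d
    apply RingOfIntegers.ext
    apply (algebraMap K M).injective
    rw [hw]
    change algebraMap K M (σ.restrictNormal K (w d)) = _
    rw [AlgHom.restrictNormal_commutes, hw, map_add, map_pow, map_pow, hσ]
    simp only [← pow_mul]
    ring_nf
  · intro R _ z hz
    have hz' : aeval z (minpoly ℤ hζ.integralPowerBasis.gen) = 0 := by
      have h1 : minpoly ℤ hζ.toInteger = minpoly ℤ ζ :=
        (minpoly.algebraMap_eq RingOfIntegers.coe_injective hζ.toInteger).symm
      rw [hζ.integralPowerBasis_gen, h1, ← cyclotomic_eq_minpoly hζ (NeZero.pos n), aeval_def,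
        ← eval_map, algebraMap_int_eq, map_cyclotomic]
      exact hz
    refine ⟨(hζ.integralPowerBasis.lift z hz').toRingHom.comp (algebraMap (𝓞 K) (𝓞 M)), ?_⟩
    intro d
    have h1 : algebraMap (𝓞 K) (𝓞 M) (w d) = hζ.toInteger ^ d + hζ.toInteger ^ ((n - 1) * d) := by
      apply RingOfIntegers.ext
      exact (hw d).trans (by simp only [map_add, map_pow]; rfl)
    have h2 : hζ.integralPowerBasis.lift z hz' hζ.toInteger = z := by
      have := hζ.integralPowerBasis.lift_gen z hz'
      rwa [hζ.integralPowerBasis_gen] at this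
    rw [RingHom.comp_apply, h1]
    simp [h2]

theorem coe_iterate_mapRingHom {K : Type*} [Field K] (T : K →+* K) (i : ℕ) (x : 𝓞 K) :
    (((RingOfIntegers.mapRingHom T)^[i] x : 𝓞 K) : K) = T^[i] (x : K) := by
  induction i generalizing x with
  | zero => rfl
  | succ i ih =>
    rw [Function.iterate_succ_apply, ih, RingOfIntegers.mapRingHom_apply,
      Function.iterate_succ_apply]

theorem isGalois_of_iterate_ne {K : Type*} [Field K] [NumberField K] (T : K ≃ₐ[ℚ] K) {x : K}
    (hx : ∀ i, 0 < i → i < Module.finrank ℚ K → T^[i] x ≠ x) :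
    IsGalois ℚ K ∧ (∀ y, T^[Module.finrank ℚ K] y = y) ∧
      Function.Bijective (fun i : Fin (Module.finrank ℚ K) => T ^ (i : ℕ)) := by
  have hcoe : ∀ i (y : K), (T ^ i) y = T^[i] y := by
    intro i y
    induction i generalizing y with
    | zero => rfl
    | succ i ih => rw [pow_succ, AlgEquiv.mul_apply, ih, Function.iterate_succ_apply]
  have hle : Fintype.card (K ≃ₐ[ℚ] K) ≤ Module.finrank ℚ K := AlgEquiv.card_le
  have hpos : 0 < Module.finrank ℚ K := Module.finrank_pos
  have hord : Module.finrank ℚ K ≤ orderOf T := by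
    by_contra! h
    refine hx (orderOf T) (orderOf_pos T) h ?_
    rw [← hcoe, pow_orderOf_eq_one, AlgEquiv.one_apply]
  have hcard : Fintype.card (K ≃ₐ[ℚ] K) = Module.finrank ℚ K :=
    le_antisymm hle (hord.trans orderOf_le_card_univ)
  have hord' : orderOf T = Module.finrank ℚ K :=
    le_antisymm (orderOf_le_card_univ.trans hle) hord
  refine ⟨IsGalois.of_card_aut_eq_finrank _ _ (by rw [Nat.card_eq_fintype_card, hcard]), ?_, ?_⟩
  · intro y
    rw [← hcoe, ← hord', pow_orderOf_eq_one, AlgEquiv.one_apply]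
  · rw [Fintype.bijective_iff_injective_and_card]
    refine ⟨?_, by rw [Fintype.card_fin, hcard]⟩
    intro i j hij
    exact Fin.ext (pow_injOn_Iio_orderOf (by simp [hord']) (by simp [hord']) hij)

theorem prod_iterate_eq_norm {K : Type*} [Field K] [NumberField K] [IsGalois ℚ K]
    {T : K ≃ₐ[ℚ] K}
    (hT : Function.Bijective (fun i : Fin (Module.finrank ℚ K) => T ^ (i : ℕ))) (y : 𝓞 K) :
    ∏ i ∈ Finset.range (Module.finrank ℚ K), (RingOfIntegers.mapRingHom (T : K →+* K))^[i] y =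
      algebraMap ℤ (𝓞 K) (Algebra.norm ℤ y) := by
  have hcoe : ∀ i (y : K), (T ^ i) y = (T : K →+* K)^[i] y := by
    intro i y
    induction i generalizing y with
    | zero => rfl
    | succ i ih =>
      rw [pow_succ, AlgEquiv.mul_apply, ih, Function.iterate_succ_apply]
      rfl
  apply RingOfIntegers.ext
  have h := Algebra.norm_eq_prod_automorphisms ℚ (y : K)
  rw [← hT.prod_comp, Fin.prod_univ_eq_prod_range (fun i => (T ^ i) (y : K))] at h
  change algebraMap (𝓞 K) K _ = algebraMap (𝓞 K) K _
  rw [map_prod]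
  change ∏ i ∈ _, (((RingOfIntegers.mapRingHom (T : K →+* K))^[i] y : 𝓞 K) : K) = _
  simp only [coe_iterate_mapRingHom, ← hcoe]
  rw [← h, ← Algebra.coe_norm_int]
  simp

end RealCyclotomic

section ConjugateValues

def conjSum (z m a : ℕ) : List ℕ → ℕ
  | [] => 1
  | d :: ds => (z ^ (a * d % 4096) + z ^ (4096 - a * d % 4096)) % m + conjSum z m a ds

def conjVal (z m : ℕ) (ds : List ℕ) (i : ℕ) : ℕ :=
  conjSum z m (1963 ^ i % 4096) ds % m

def hornerVal (z m : ℕ) (ds : List ℕ) (e₁ e₂ : ℕ) : ℕ → ℕ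
  | 0 => 1
  | n + 1 => hornerVal z m ds e₁ e₂ n ^ 181 * (conjVal z m ds n ^ e₁ % m) ^ e₂ % m

def prodVal (z m : ℕ) (ds : List ℕ) : ℕ → ℕ
  | 0 => 1
  | n + 1 => prodVal z m ds n * conjVal z m ds n % m

def diffProdVal (z m : ℕ) : ℕ → ℕ
  | 0 => 1
  | n + 1 => diffProdVal z m n * (conjVal z m [1] (n + 1) + (m - conjVal z m [1] 0)) % m

/-- The monoid homomorphism `v ↦ ∏ i < n, ρ (T ^ i v) ^ (e * c ^ (n - 1 - i))`. -/
def hornerHom {O R : Type*} [CommRing O] [CommRing R] (T : O →+* O) (ρ : O →+* R) (c e : ℕ) :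
    ℕ → (O →* R)
  | 0 => 1
  | n + 1 => hornerHom T ρ c e n ^ c * ((ρ.comp (T ^ n) : O →+* R) : O →* R) ^ e

section

variable {O R : Type*} [CommRing O] [CommRing R] (T : O →+* O) (ρ : O →+* R) {c e : ℕ}

theorem hornerHom_succ_apply (n : ℕ) (v : O) :
    hornerHom T ρ c e (n + 1) v = hornerHom T ρ c e n v ^ c * ρ (T^[n] v) ^ e := by
  simp [hornerHom, RingHom.coe_pow]

theorem hornerHom_map_mul (n : ℕ) (v : O) :
    hornerHom T ρ c e n (T v) * ρ v ^ (e * c ^ n) = hornerHom T ρ c e (n + 1) v := by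
  induction n with
  | zero => simp [hornerHom]
  | succ n ih =>
    rw [hornerHom_succ_apply T ρ (n + 1), ← ih, hornerHom_succ_apply, Function.iterate_succ_apply]
    ring

theorem hornerHom_map {p n : ℕ} (hT : ∀ v, T^[n] v = v) (hc : c ^ n ≡ 1 [MOD p]) {v : O}
    (hv : IsUnit (ρ v)) (hvp : (ρ v ^ e) ^ p = 1) :
    hornerHom T ρ c e n (T v) = hornerHom T ρ c e n v ^ c := by
  have h := hornerHom_map_mul T ρ (c := c) (e := e) n v
  have h1 : ρ v ^ (e * c ^ n) = ρ v ^ e := by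
    rw [pow_mul, pow_eq_pow_mod _ hvp, hc, ← pow_eq_pow_mod _ hvp, pow_one]
  rw [hornerHom_succ_apply, hT, h1] at h
  exact (hv.pow e).mul_right_cancel h

theorem hornerHom_eq_one (n : ℕ) {v : O} (hv : ∀ i, ρ (T^[i] v) ^ e = 1) :
    hornerHom T ρ c e n v = 1 := by
  induction n with
  | zero => rfl
  | succ n ih => rw [hornerHom_succ_apply, ih, hv, one_pow, one_mul]

theorem hornerHom_pow_eq_one (n : ℕ) {p : ℕ} {v : O} (hv : ∀ i, (ρ (T^[i] v) ^ e) ^ p = 1) :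
    hornerHom T ρ c e n v ^ p = 1 := by
  induction n with
  | zero => exact one_pow _
  | succ n ih =>
    rw [hornerHom_succ_apply, mul_pow, hv, ← pow_mul, mul_comm c, pow_mul, ih, one_pow, one_mul]

end

section

variable {O : Type*} [CommRing O] {T : O →+* O} {w : ℕ → O} (hT : ∀ d, T (w d) = w (1963 * d))
  {m z : ℕ} (hz : (z : ZMod m) ^ 4096 = 1) {ρ : O →+* ZMod m}
  (hρ : ∀ d, ρ (w d) = (z : ZMod m) ^ d + (z : ZMod m) ^ (4095 * d))

include hT hz hρ

theorem map_iterate_eq_conjVal (ds : List ℕ) (i : ℕ) :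
    ρ (T^[i] (1 + (ds.map w).sum)) = (conjVal z m ds i : ZMod m) := by
  have hTi : ∀ i d, T^[i] (w d) = w (1963 ^ i * d) := by
    intro i
    induction i with
    | zero => simp
    | succ i ih => intro d; rw [Function.iterate_succ_apply', ih, hT, pow_succ']; ring_nf
  have hterm : ∀ d, ρ (T^[i] (w d)) = ((z ^ (1963 ^ i % 4096 * d % 4096) +
      z ^ (4096 - 1963 ^ i % 4096 * d % 4096) : ℕ) : ZMod m) := by
    intro d
    have hmod : 1963 ^ i % 4096 * d % 4096 = 1963 ^ i * d % 4096 := by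
      rw [Nat.mod_mul_mod]
    rw [hTi, hρ, hmod]
    generalize 1963 ^ i * d = k
    push_cast
    congr 1
    · exact pow_eq_pow_mod k hz
    · have hu : IsUnit ((z : ZMod m) ^ k) :=
        (IsUnit.of_pow_eq_one hz (by norm_num)).pow k
      apply hu.mul_left_cancel
      rw [← pow_add, show k + 4095 * k = 4096 * k by ring, pow_mul, hz, one_pow,
        pow_eq_pow_mod k hz, ← pow_add, Nat.add_sub_cancel' (Nat.mod_lt k (by norm_num)).le, hz]
  rw [conjVal, ZMod.natCast_mod]
  induction ds with
  | nil => simp [conjSum, iterate_map_one]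
  | cons d ds ih =>
    rw [List.map_cons, List.sum_cons, conjSum, Nat.cast_add, ZMod.natCast_mod, ← ih, ← hterm,
      ← map_add, ← iterate_map_add]
    congr 2
    ring

theorem hornerHom_eq_hornerVal (ds : List ℕ) (e₁ e₂ n : ℕ) :
    hornerHom T ρ 181 (e₁ * e₂) n (1 + (ds.map w).sum) =
      (hornerVal z m ds e₁ e₂ n : ZMod m) := by
  induction n with
  | zero => simp [hornerHom, hornerVal]
  | succ n ih =>
    rw [hornerHom_succ_apply, ih, map_iterate_eq_conjVal hT hz hρ, hornerVal, ZMod.natCast_mod]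
    push_cast
    rw [ZMod.natCast_mod]
    push_cast
    rw [pow_mul]

theorem map_prod_eq_prodVal (ds : List ℕ) (n : ℕ) :
    ρ (∏ i ∈ Finset.range n, T^[i] (1 + (ds.map w).sum)) = (prodVal z m ds n : ZMod m) := by
  induction n with
  | zero => simp [prodVal]
  | succ n ih =>
    rw [Finset.prod_range_succ, map_mul, ih, map_iterate_eq_conjVal hT hz hρ, prodVal,
      ZMod.natCast_mod, Nat.cast_mul]

theorem map_prod_sub_eq_diffProdVal (hm : 0 < m) (n : ℕ) :
    ρ (∏ j ∈ Finset.range n, (T^[j + 1] (w 1) - w 1)) = (diffProdVal z m n : ZMod m) := by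
  have hval : ∀ i, ρ (T^[i] (w 1)) = (conjVal z m [1] i : ZMod m) - 1 := by
    intro i
    have h := map_iterate_eq_conjVal hT hz hρ [1] i
    simp only [List.map_cons, List.map_nil, List.sum_cons, List.sum_nil, add_zero,
      iterate_map_add, iterate_map_one, map_add, map_one] at h
    rw [← h]
    ring
  induction n with
  | zero => simp [diffProdVal]
  | succ n ih =>
    have h0 := hval 0
    have hle : conjVal z m [1] 0 ≤ m := (Nat.mod_lt _ hm).le
    rw [Function.iterate_zero_apply] at h0
    rw [Finset.prod_range_succ, map_mul, ih, map_sub, hval, h0, diffProdVal,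
      ZMod.natCast_mod, Nat.cast_mul, Nat.cast_add, Nat.cast_sub hle, ZMod.natCast_self]
    ring

end

theorem exists_eq_one_and_iterate_eq_zero {O : Type*} [CommRing O] (T : O →+* O) {m : ℕ}
    [NeZero m] (ρ : O →+* ZMod m) (x : O) {n : ℕ}
    (h : IsUnit (ρ (∏ j ∈ Finset.range n, (T^[j + 1] x - x)))) :
    ∃ e : O, ρ e = 1 ∧ ∀ i < n, ρ (T^[i + 1] e) = 0 := by
  obtain ⟨u, hu⟩ := ZMod.natCast_zmod_surjective (n := m) (↑h.unit⁻¹ : ZMod m)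
  have hlift : ∀ i, ∃ k : ℕ, (k : ZMod m) = ρ (T^[i] x) := fun i =>
    ZMod.natCast_zmod_surjective _
  choose k hk using hlift
  have hmap : ∀ i, ρ (T^[i] ((u : O) * ∏ j ∈ Finset.range n, ((k (j + 1) : O) - x))) =
      u * ∏ j ∈ Finset.range n, (ρ (T^[j + 1] x) - ρ (T^[i] x)) := by
    intro i
    rw [← RingHom.coe_pow]
    simp only [map_mul, map_natCast, map_prod, map_sub, hk]
  refine ⟨(u : O) * ∏ j ∈ Finset.range n, ((k (j + 1) : O) - x), ?_, fun i hi => ?_⟩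
  · have h0 := hmap 0
    simp only [Function.iterate_zero_apply] at h0
    rw [h0, hu]
    simp only [map_prod, map_sub] at h
    simpa only [map_prod, map_sub] using h.val_inv_mul
  · rw [hmap, Finset.prod_eq_zero (Finset.mem_range.mpr hi) (sub_self _), mul_zero]

end ConjugateValues

section NormCongruence

open NumberField

/-- In a number field containing a primitive `n`-th root of unity, ideals of norm prime to `n` have
norm congruent to `1` modulo `n`. -/
theorem absNorm_modEq_one {M : Type*} [Field M] [NumberField M] {n : ℕ} [NeZero n] {ζ : 𝓞 M}
    (hζ : IsPrimitiveRoot ζ n) (I : Ideal (𝓞 M)) (hI : (Ideal.absNorm I).Coprime n) :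
    Ideal.absNorm I ≡ 1 [MOD n] := by
  induction I using UniqueFactorizationMonoid.induction_on_prime with
  | h₁ =>
    have h0 : n = 1 := by simpa using hI
    subst h0
    exact Nat.modEq_one
  | h₂ I hu =>
    rw [Ideal.isUnit_iff.1 hu, Ideal.absNorm_top]
  | h₃ I P hI0 hP ih =>
    rw [map_mul] at hI ⊢
    have hI' := Nat.Coprime.coprime_mul_left hI
    have hP' := Nat.Coprime.coprime_mul_right hI
    have hPp : P.IsPrime := Ideal.isPrime_of_prime hP
    have hPm : P.IsMaximal := hPp.isMaximal hP.ne_zero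
    have h1 : Ideal.absNorm P ≠ 1 := fun h => hPp.ne_top (Ideal.absNorm_eq_one_iff.1 h)
    have hprim := hζ.idealQuotient_mk h1 hP'
    let _ : Field (𝓞 M ⧸ P) := Ideal.Quotient.field P
    have : Finite (𝓞 M ⧸ P) := Ideal.finiteQuotientOfFreeOfNeBot P hP.ne_zero
    let _ : Fintype (𝓞 M ⧸ P) := Fintype.ofFinite _
    have hcard : Fintype.card (𝓞 M ⧸ P) = Ideal.absNorm P := by
      rw [Ideal.absNorm_apply, Submodule.cardQuot_apply, Nat.card_eq_fintype_card]
    have hpow := FiniteField.pow_card_sub_one_eq_one _ (hprim.ne_zero (NeZero.ne n))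
    have hdvd := hprim.dvd_of_pow_eq_one _ hpow
    have hP1 : Ideal.absNorm P ≡ 1 [MOD n] := by
      rw [hcard] at hdvd
      refine ((Nat.modEq_iff_dvd' ?_).2 hdvd).symm
      exact Nat.one_le_iff_ne_zero.2 fun h => hP.ne_zero (Ideal.absNorm_eq_zero_iff.1 h)
    simpa using hP1.mul (ih hI')

theorem natCast_norm_pow_eq_one {L M : Type*} [Field L] [NumberField L] [Field M] [NumberField M]
    [Algebra L M] {n : ℕ} [NeZero n] {ζ : M} (hζ : IsPrimitiveRoot ζ n) (y : 𝓞 L)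
    (hy : IsUnit ((Algebra.norm ℤ y : ℤ) : ZMod n)) :
    ((Algebra.norm ℤ y : ℤ) : ZMod n) ^ (2 * Module.finrank L M) = 1 := by
  have hζ' : IsPrimitiveRoot hζ.toInteger n := hζ.toInteger_isPrimitiveRoot
  set N : ℤ := Algebra.norm ℤ y
  have hnorm : Algebra.norm ℤ (algebraMap (𝓞 L) (𝓞 M) y) = N ^ Module.finrank L M := by
    apply Int.cast_injective (α := ℚ)
    rw [Algebra.coe_norm_int, ← Algebra.norm_norm (S := L)]
    change Algebra.norm ℚ (Algebra.norm L (algebraMap L M (y : L))) = _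
    rw [Algebra.norm_algebraMap, map_pow, ← Algebra.coe_norm_int]
    push_cast
    rfl
  have habs : Ideal.absNorm (Ideal.span {algebraMap (𝓞 L) (𝓞 M) y}) =
      N.natAbs ^ Module.finrank L M := by
    rw [Ideal.absNorm_span_singleton, hnorm, Int.natAbs_pow]
  have hunit : IsUnit ((N.natAbs : ℕ) : ZMod n) := by
    rcases Int.natAbs_eq N with h | h
    · rw [h] at hy
      simpa using hy
    · rw [h] at hy
      simpa using hy
  have hcop : N.natAbs.Coprime n := (ZMod.isUnit_iff_coprime _ _).1 hunit
  have hmod := absNorm_modEq_one hζ' (Ideal.span {algebraMap (𝓞 L) (𝓞 M) y})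
    (by rw [habs]; exact hcop.pow_left _)
  rw [habs, ← ZMod.natCast_eq_natCast_iff] at hmod
  have hsq : (N : ZMod n) ^ 2 = (N.natAbs : ZMod n) ^ 2 := by
    rcases Int.natAbs_eq N with h | h
    · nth_rw 1 [h]; simp
    · nth_rw 1 [h]; simp
  push_cast at hmod
  rw [pow_mul, hsq, ← pow_mul, mul_comm, pow_mul, hmod, one_pow]

theorem dvd_norm_add_mul_sub_norm {K L : Type*} [Field K] [NumberField K] [Field L] [NumberField L]
    [Algebra K L] [IsGalois K L] (δ : 𝓞 K) (β γ : 𝓞 L) :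
    δ ∣ RingOfIntegers.norm K (β + algebraMap (𝓞 K) (𝓞 L) δ * γ) - RingOfIntegers.norm K β := by
  have hprod : ∀ x : 𝓞 L, algebraMap (𝓞 K) (𝓞 L) (RingOfIntegers.norm K x) =
      ∏ σ : L ≃ₐ[K] L, RingOfIntegers.mapRingHom (σ : L →+* L) x := by
    intro x
    apply RingOfIntegers.coe_injective
    change algebraMap K L (RingOfIntegers.norm K x : K) = _
    rw [RingOfIntegers.coe_norm, Algebra.norm_eq_prod_automorphisms, map_prod]
    rfl
  obtain ⟨t, ht⟩ : algebraMap (𝓞 K) (𝓞 L) δ ∣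
      algebraMap (𝓞 K) (𝓞 L) (RingOfIntegers.norm K (β + algebraMap (𝓞 K) (𝓞 L) δ * γ) -
        RingOfIntegers.norm K β) := by
    rw [map_sub, hprod, hprod, ← Ideal.mem_span_singleton, ← Ideal.Quotient.mk_eq_mk_iff_sub_mem,
      map_prod, map_prod]
    refine Finset.prod_congr rfl fun σ _ => ?_
    rw [Ideal.Quotient.mk_eq_mk_iff_sub_mem, Ideal.mem_span_singleton]
    have : RingOfIntegers.mapRingHom (σ : L →+* L) (algebraMap (𝓞 K) (𝓞 L) δ) =
        algebraMap (𝓞 K) (𝓞 L) δ := RingOfIntegers.ext (σ.commutes (δ : K))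
    rw [map_add, map_mul, this]
    simp
  set a := RingOfIntegers.norm K (β + algebraMap (𝓞 K) (𝓞 L) δ * γ) - RingOfIntegers.norm K β
  have ht' : algebraMap K L a = algebraMap K L δ * (t : L) :=
    congrArg (algebraMap (𝓞 L) L) ht
  by_cases hδ : δ = 0
  · subst hδ
    have : a = 0 := by
      apply RingOfIntegers.coe_injective
      apply (algebraMap K L).injective
      rw [ht']
      simp
    rw [this]
  · have hδ' : (δ : K) ≠ 0 := RingOfIntegers.coe_ne_zero_iff.2 hδ
    have hq : algebraMap K L ((a : K) / δ) = t := by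
      rw [map_div₀, ht', mul_div_cancel_left₀]
      simpa using hδ'
    have hint : IsIntegral ℤ ((a : K) / δ) := by
      rw [← isIntegral_algebraMap_iff (algebraMap K L).injective, hq]
      exact t.isIntegral_coe
    refine ⟨⟨_, hint⟩, RingOfIntegers.ext ?_⟩
    change (a : K) = (δ : K) * ((a : K) / δ)
    field_simp

end NormCongruence

section NormCharacter

open NumberField

variable {K L M : Type*} [Field K] [NumberField K] [Field L] [NumberField L] [Field M]
  [NumberField M] [Algebra K L] [Algebra L M] [IsGalois ℚ K] [IsGalois K L]

theorem map_norm_pow_eq_one {T : K ≃ₐ[ℚ] K}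
    (hT : Function.Bijective (fun i : Fin (Module.finrank ℚ K) => T ^ (i : ℕ)))
    {n : ℕ} [NeZero n] {ζ : M} (hζ : IsPrimitiveRoot ζ n) (ρ : 𝓞 K →+* ZMod n) {e : 𝓞 K}
    (he : ρ e = 1) (he' : ∀ i, i + 1 < Module.finrank ℚ K →
      ρ ((RingOfIntegers.mapRingHom (T : K →+* K))^[i + 1] e) = 0)
    (β : 𝓞 L) (hβ : IsUnit (ρ (RingOfIntegers.norm K β))) :
    ρ (RingOfIntegers.norm K β) ^ (2 * Module.finrank L M) = 1 := by
  set S := RingOfIntegers.mapRingHom (T : K →+* K)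
  set β' : 𝓞 L := β + algebraMap (𝓞 K) (𝓞 L) (e - 1) * (β - 1) with hβ'
  have hβ'' : β' = 1 + algebraMap (𝓞 K) (𝓞 L) e * (β - 1) := by
    rw [hβ', map_sub, map_one]
    ring
  have h0 : ρ (RingOfIntegers.norm K β') = ρ (RingOfIntegers.norm K β) := by
    obtain ⟨t, ht⟩ := dvd_norm_add_mul_sub_norm (K := K) (e - 1) β (β - 1)
    rw [← hβ'] at ht
    have := congrArg ρ ht
    rwa [map_mul, map_sub, map_sub, he, map_one, sub_self, zero_mul, sub_eq_zero] at this
  have h1 : ∀ i, i + 1 < Module.finrank ℚ K →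
      ρ (S^[i + 1] (RingOfIntegers.norm K β')) = 1 := by
    intro i hi
    obtain ⟨t, ht⟩ := dvd_norm_add_mul_sub_norm (K := K) e (1 : 𝓞 L) (β - 1)
    have := congrArg (fun x => ρ ((S ^ (i + 1)) x)) ht
    simp only [map_mul, map_sub, map_one] at this
    rw [RingHom.coe_pow, he' i hi, zero_mul, sub_eq_zero, ← hβ''] at this
    exact this
  have hN : ((Algebra.norm ℤ β' : ℤ) : ZMod n) = ρ (RingOfIntegers.norm K β) := by
    have hnorm : Algebra.norm ℤ (RingOfIntegers.norm K β') = Algebra.norm ℤ β' := by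
      apply Int.cast_injective (α := ℚ)
      rw [Algebra.coe_norm_int, Algebra.coe_norm_int, RingOfIntegers.coe_norm, Algebra.norm_norm]
    have h := congrArg ρ (prod_iterate_eq_norm hT (RingOfIntegers.norm K β'))
    rw [hnorm, eq_intCast, map_intCast] at h
    rw [← h, map_prod]
    obtain ⟨N, hN⟩ := Nat.exists_eq_succ_of_ne_zero
      (Module.finrank_pos (R := ℚ) (M := K)).ne'
    rw [hN, Finset.prod_range_succ', Finset.prod_eq_one, one_mul]
    · exact h0
    · intro i hi
      exact h1 i (by rw [hN]; exact Nat.succ_lt_succ (Finset.mem_range.1 hi))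
  rw [← hN]
  exact natCast_norm_pow_eq_one hζ β' (by rwa [hN])

theorem map_iterate_norm_pow_eq_one {T : K ≃ₐ[ℚ] K}
    (hT : Function.Bijective (fun i : Fin (Module.finrank ℚ K) => T ^ (i : ℕ)))
    (hT' : ∀ y : 𝓞 K, (RingOfIntegers.mapRingHom (T : K →+* K))^[Module.finrank ℚ K] y = y)
    {n : ℕ} [NeZero n] {ζ : M} (hζ : IsPrimitiveRoot ζ n) (ρ : 𝓞 K →+* ZMod n) {e : 𝓞 K}
    (he : ρ e = 1) (he' : ∀ i, i + 1 < Module.finrank ℚ K →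
      ρ ((RingOfIntegers.mapRingHom (T : K →+* K))^[i + 1] e) = 0)
    (β : 𝓞 L) (i : ℕ)
    (hβ : IsUnit (ρ ((RingOfIntegers.mapRingHom (T : K →+* K))^[i] (RingOfIntegers.norm K β)))) :
    ρ ((RingOfIntegers.mapRingHom (T : K →+* K))^[i] (RingOfIntegers.norm K β)) ^
      (2 * Module.finrank L M) = 1 := by
  set S := RingOfIntegers.mapRingHom (T : K →+* K)
  set N := Module.finrank ℚ K with hN
  have hS : ∀ y, S^[i] (S^[(N - 1) * i] y) = y := by
    intro y
    have h1 : i + (N - 1) * i = N * i := by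
      obtain ⟨N', hN'⟩ := Nat.exists_eq_succ_of_ne_zero
        (Module.finrank_pos (R := ℚ) (M := K)).ne'
      rw [hN, hN', Nat.succ_sub_one, Nat.succ_mul, add_comm]
    rw [← Function.iterate_add_apply, h1, Function.iterate_mul]
    exact Function.iterate_fixed (hT' y) i
  have hcoe : ∀ y, (ρ.comp (S ^ i : 𝓞 K →+* 𝓞 K)) y = ρ (S^[i] y) := fun y => by
    rw [RingHom.comp_apply, RingHom.coe_pow]
  rw [← hcoe] at hβ ⊢
  refine map_norm_pow_eq_one hT hζ _ (e := S^[(N - 1) * i] e) ?_ ?_ β hβ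
  · rw [hcoe, hS, he]
  · intro j hj
    rw [hcoe, (Function.Commute.refl S).iterate_iterate i (j + 1) |>.eq,
      hS]
    exact he' j hj

end NormCharacter

section PrincipalNorm

open NumberField Ideal

variable {K L : Type*} [Field K] [NumberField K] [Field L] [NumberField L] [Algebra K L]

theorem exists_relNorm_eq_span_pow (M : Type*) [Field M] [NumberField M]
    [Algebra L M] {m q : ℕ} [NeZero m] [IsCyclotomicExtension {m} ℚ M] (hq : q.Prime)
    (hqm : ¬ q ∣ m) {α : 𝓞 K} (hα : (Algebra.norm ℤ α).natAbs = q) :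
    ∃ (Q : Ideal (𝓞 L)) (f : ℕ), Q ≠ ⊥ ∧ f ∣ orderOf (q : ZMod m) ∧
      relNorm (𝓞 K) Q = span {α} ^ f := by
  have : Fact q.Prime := ⟨hq⟩
  have habs : absNorm (span {α}) = q := by rw [absNorm_span_singleton, hα]
  set P : Ideal (𝓞 K) := span {α}
  have hPp : P.IsPrime := isPrime_of_irreducible_absNorm (by rw [habs]; exact hq)
  have hP0 : P ≠ ⊥ := by
    intro h
    rw [h, absNorm_bot] at habs
    exact hq.ne_zero habs.symm
  have hPm : P.IsMaximal := hPp.isMaximal hP0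
  have hPq : P.LiesOver (span {(q : ℤ)}) := by
    have := absNorm_mem P
    rw [habs] at this
    have hmax : (span {(q : ℤ)}).IsMaximal :=
      (PrincipalIdealRing.isMaximal_of_irreducible (Nat.prime_iff_prime_int.1 hq).irreducible)
    refine ⟨hmax.eq_of_le (IsPrime.under ℤ P).ne_top ?_⟩
    rw [span_singleton_le_iff_mem, mem_comap]
    simpa using this
  obtain ⟨Q, hQm, hQ⟩ := exists_maximal_ideal_liesOver_of_isIntegral (S := 𝓞 L) P
  obtain ⟨R, hRm, hR⟩ := exists_maximal_ideal_liesOver_of_isIntegral (S := 𝓞 M) Q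
  have hQq : Q.LiesOver (span {(q : ℤ)}) := LiesOver.trans Q P _
  have hRq : R.LiesOver (span {(q : ℤ)}) := LiesOver.trans R Q _
  have hRp := hRm.isPrime
  have hdeg := IsCyclotomicExtension.Rat.inertiaDeg_eq_of_not_dvd q M R hqm
  refine ⟨Q, Q.inertiaDeg (𝓞 K), ?_, ?_, relNorm_eq_pow_of_isMaximal Q P⟩
  · rintro rfl
    refine hP0 ?_
    rw [hQ.over]
    exact comap_bot_of_injective _ (FaithfulSMul.algebraMap_injective _ _)
  · rw [← hdeg, inertiaDeg_tower (R := ℤ) Q R, inertiaDeg_tower (R := ℤ) P Q]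
    exact (dvd_mul_left _ _).mul_right _

theorem exists_norm_eq_unit_mul_pow [IsGalois K L] {Q : Ideal (𝓞 L)} {f : ℕ} (hQ : Q ≠ ⊥)
    {α : 𝓞 K} (h : relNorm (𝓞 K) Q = span {α} ^ f) :
    ∃ (β : 𝓞 L) (ε : (𝓞 K)ˣ), RingOfIntegers.norm K β =
      ε * α ^ (f * Nat.card (ClassGroup (𝓞 L))) := by
  set c := Nat.card (ClassGroup (𝓞 L))
  have h1 : ClassGroup.mk0 (⟨Q, mem_nonZeroDivisors_of_ne_zero hQ⟩ ^ c) = 1 := by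
    rw [map_pow, pow_card_eq_one']
  rw [ClassGroup.mk0_eq_one_iff] at h1
  obtain ⟨β, hβ⟩ := h1.principal
  change Q ^ c = span {β} at hβ
  have h2 : span {RingOfIntegers.norm K β} = span {α ^ (f * c)} := by
    rw [← span_singleton_pow, pow_mul, ← h, ← map_pow, hβ, relNorm_singleton]
    congr 2
    apply RingOfIntegers.coe_injective
    refine (RingOfIntegers.coe_norm K β).trans ?_
    exact (Algebra.algebraMap_intNorm (L := L) β).symm
  obtain ⟨ε, hε⟩ := span_singleton_eq_span_singleton.1 h2.symm
  exact ⟨β, ε, by rw [← hε, mul_comm]⟩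

end PrincipalNorm

section NormValue

open NumberField Polynomial

theorem eval_cyclotomic_eq_zero {R : Type*} [CommRing R] {z : R} (hz : z ^ 2048 + 1 = 0) :
    (cyclotomic 4096 R).eval z = 0 := by
  have : Fact (Nat.Prime 2) := ⟨Nat.prime_two⟩
  have h := cyclotomic_prime_pow_eq_geom_sum (R := R) Nat.prime_two (n := 11)
  norm_num at h
  simp [h, hz]

theorem norm_eq_of_prodVal_eq {K : Type*} [Field K] [NumberField K]
    {n : ℕ} (hK : Module.finrank ℚ K = n) [IsGalois ℚ K] {T : K ≃ₐ[ℚ] K}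
    (hT : Function.Bijective (fun i : Fin (Module.finrank ℚ K) => T ^ (i : ℕ)))
    {w : ℕ → 𝓞 K} (hw : ∀ d, RingOfIntegers.mapRingHom (T : K →+* K) (w d) = w (1963 * d))
    (hρ : ∀ (R : Type) [CommRing R] (z : R), (cyclotomic 4096 R).eval z = 0 →
      ∃ ρ : 𝓞 K →+* R, ∀ d, ρ (w d) = z ^ d + z ^ (4095 * d))
    {m z₀ : ℕ} (hz₀ : (z₀ : ZMod m) ^ 2048 + 1 = 0) (ds : List ℕ) (N : ℤ)
    (hN : (prodVal z₀ m ds n : ZMod m) = N)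
    (hbound : (1 + 2 * ds.length) ^ n + N.natAbs < m) :
    Algebra.norm ℤ (1 + (ds.map w).sum) = N := by
  set α := 1 + (ds.map w).sum with hα
  set S := RingOfIntegers.mapRingHom (T : K →+* K)
  have hprod := prod_iterate_eq_norm hT α
  rw [hK, eq_intCast] at hprod
  have hmod : ((Algebra.norm ℤ α : ℤ) : ZMod m) = N := by
    obtain ⟨ρ, hρ'⟩ := hρ _ _ (eval_cyclotomic_eq_zero hz₀)
    have hz₀' : (z₀ : ZMod m) ^ 4096 = 1 := by
      linear_combination ((z₀ : ZMod m) ^ 2048 - 1) * hz₀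
    have h := map_prod_eq_prodVal hw hz₀' hρ' ds n
    rw [hprod, map_intCast] at h
    rw [h, hN]
  have habs : |Algebra.norm ℤ α| ≤ (1 + 2 * ds.length) ^ n := by
    set z : ℂ := Complex.exp (2 * Real.pi * Complex.I / 4096)
    have hz : IsPrimitiveRoot z 4096 := by
      simpa using Complex.isPrimitiveRoot_exp 4096 (by norm_num)
    have hz1 : ‖z‖ = 1 := hz.norm'_eq_one (by norm_num)
    obtain ⟨ρ, hρ'⟩ := hρ _ z (hz.isRoot_cyclotomic (by norm_num))
    have hTi : ∀ i d, S^[i] (w d) = w (1963 ^ i * d) := by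
      intro i
      induction i with
      | zero => simp
      | succ i ih => intro d; rw [Function.iterate_succ_apply', ih, hw, pow_succ']; ring_nf
    have hle : ∀ i, ‖ρ (S^[i] α)‖ ≤ 1 + 2 * ds.length := by
      intro i
      rw [hα]
      clear hN hbound hmod hprod hα α
      induction ds with
      | nil => simp [iterate_map_one]
      | cons d ds ih =>
        have h1 : S^[i] (1 + ((d :: ds).map w).sum) =
            w (1963 ^ i * d) + S^[i] (1 + (ds.map w).sum) := by
          rw [← hTi, ← iterate_map_add]
          simp only [List.map_cons, List.sum_cons]
          congr 1
          ring
        rw [h1, map_add, hρ', List.length_cons, Nat.cast_succ]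
        refine (norm_add_le _ _).trans ?_
        have h2 := norm_add_le (z ^ (1963 ^ i * d)) (z ^ (4095 * (1963 ^ i * d)))
        rw [norm_pow, norm_pow, hz1, one_pow, one_pow] at h2
        linarith
    have h := congrArg (fun x => ‖ρ x‖) hprod
    simp only [map_intCast, map_prod, norm_prod, Complex.norm_intCast] at h
    have h3 := Finset.prod_le_prod (s := Finset.range n)
      (fun i _ => norm_nonneg (ρ (S^[i] α))) (fun i _ => hle i)
    rw [h, Finset.prod_const, Finset.card_range] at h3
    exact_mod_cast h3
  rw [ZMod.intCast_eq_intCast_iff, Int.modEq_iff_dvd] at hmod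
  have hlt : |N - Algebra.norm ℤ α| < (m : ℤ) := by
    have h1 := abs_sub N (Algebra.norm ℤ α)
    have h2 : (((1 + 2 * ds.length) ^ n + N.natAbs : ℕ) : ℤ) < (m : ℤ) :=
      Int.ofNat_lt.2 hbound
    rw [Nat.cast_add, Int.natCast_natAbs] at h2
    have h3 : (((1 + 2 * ds.length) ^ n : ℕ) : ℤ) = (1 + 2 * ds.length) ^ n := by
      norm_cast
    rw [h3] at h2
    omega
  have := Int.eq_zero_of_abs_lt_dvd hmod hlt
  omega

end NormValue

section Computations

set_option maxRecDepth 100000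

theorem hornerVal_unit : hornerVal 637333705 (114689 ^ 2) [1] 448 256 1024 = 1 := by
  decide +kernel

theorem hornerVal_prime :
    hornerVal 637333705 (114689 ^ 2) [1, 508, 774, 1538] 448 256 1024 = 10234043538 := by
  decide +kernel

theorem hornerVal_unit_auxiliary :
    hornerVal 11669485081 19730178049 [1] 672 256 1024 = 5542103747 := by
  decide +kernel

theorem prime_auxiliary : Nat.Prime 19730178049 := by
  have hpow : ∀ a e₁ e₂ e₃ : ℕ, (a : ZMod 19730178049) ^ (e₁ * e₂ * e₃) =
      (((a ^ e₁ % 19730178049) ^ e₂ % 19730178049) ^ e₃ % 19730178049 : ℕ) := by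
    intro a e₁ e₂ e₃
    simp only [ZMod.natCast_mod, Nat.cast_pow, pow_mul]
  have hne : ∀ e₁ e₂ e₃ : ℕ,
      ((11 ^ e₁ % 19730178049) ^ e₂ % 19730178049) ^ e₃ % 19730178049 % 19730178049 ≠
        1 % 19730178049 →
      ((11 : ℕ) : ZMod 19730178049) ^ (e₁ * e₂ * e₃) ≠ 1 := by
    intro e₁ e₂ e₃ h h'
    rw [hpow, ← Nat.cast_one (R := ZMod 19730178049), ZMod.natCast_eq_natCast_iff] at h'
    exact h h'
  refine lucas_primality _ ((11 : ℕ) : ZMod 19730178049) ?_ fun q hq hqd => ?_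
  · refine (hpow 11 42 4096 114689).trans ?_
    rw [← Nat.cast_one (R := ZMod 19730178049), ZMod.natCast_eq_natCast_iff]
    decide +kernel
  · have hq' : q ∣ 2 ^ 13 * 3 * 7 * 114689 := hqd
    have hpr : ∀ {r : ℕ}, r.Prime → q ∣ r → q = r := fun hr h =>
      (Nat.prime_dvd_prime_iff_eq hq hr).1 h
    rw [hq.dvd_mul, hq.dvd_mul, hq.dvd_mul] at hq'
    rcases hq' with ((h | h) | h) | h
    · rw [hpr Nat.prime_two (hq.dvd_of_dvd_pow h)]
      exact hne 21 4096 114689 (by decide +kernel)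
    · rw [hpr Nat.prime_three h]
      exact hne 14 4096 114689 (by decide +kernel)
    · rw [hpr (by norm_num) h]
      exact hne 6 4096 114689 (by decide +kernel)
    · rw [hpr (by norm_num) h]
      exact hne 42 4096 1 (by decide +kernel)

theorem diffProdVal_coprime : (diffProdVal 637333705 (114689 ^ 2) 1023).Coprime 114689 := by
  decide +kernel

theorem natCast_eq_intCast_neg {m a b : ℕ} (h : (a + b) % m = 0) :
    (a : ZMod m) = ((-(b : ℤ) : ℤ) : ZMod m) := by
  have := (ZMod.natCast_eq_zero_iff (a + b) m).2 (Nat.dvd_of_mod_eq_zero h)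
  push_cast at this ⊢
  exact eq_neg_of_add_eq_zero_left this

theorem natCast_pow_add_one_eq_zero {m z k : ℕ} (h : (z ^ k + 1) % m = 0) :
    (z : ZMod m) ^ k + 1 = 0 := by
  have := (ZMod.natCast_eq_zero_iff (z ^ k + 1) m).2 (Nat.dvd_of_mod_eq_zero h)
  push_cast at this
  exact this

theorem exists_norm_residues : ∃ m z q : ℕ, (z : ZMod m) ^ 2048 + 1 = 0 ∧ q.Prime ∧
    (prodVal z m [1] 1024 : ZMod m) = ((-((1 : ℕ) : ℤ) : ℤ) : ZMod m) ∧
    (prodVal z m [1, 508, 774, 1538] 1024 : ZMod m) = ((-(q : ℤ) : ℤ) : ZMod m) ∧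
    (1 + 2 * [1].length) ^ 1024 + (-((1 : ℕ) : ℤ)).natAbs < m ∧
    (1 + 2 * [1, 508, 774, 1538].length) ^ 1024 + (-(q : ℤ)).natAbs < m ∧
    ¬ q ∣ 4096 * 114689 ^ 2 ∧ q ^ 114688 % (4096 * 114689 ^ 2) = 1 := by
  refine ⟨2 ^ 4096 + 1, 4, _, natCast_pow_add_one_eq_zero ?_, prime_certificate,
    natCast_eq_intCast_neg ?_, natCast_eq_intCast_neg ?_, ?_, ?_, ?_, ?_⟩
  · decide +kernel
  · decide +kernel
  · decide +kernel
  · rw [Int.natAbs_neg, Int.natAbs_natCast]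
    decide +kernel
  · rw [Int.natAbs_neg, Int.natAbs_natCast]
    decide +kernel
  · decide +kernel
  · rw [Nat.pow_mod]
    decide +kernel

end Computations

section ClassNumber

open NumberField Polynomial

theorem map_hornerHom_pow_eq_one {O : Type*} [CommRing O] (T : O →+* O) {m p e : ℕ}
    (hm : Nat.totient m = e * p) (ρ : O →+* ZMod m) (c n : ℕ) (v : Oˣ) :
    Units.map (hornerHom T ρ c e n) v ^ p = 1 := by
  apply Units.ext
  refine hornerHom_pow_eq_one T ρ n fun i => ?_
  have h := ZMod.pow_totient (Units.map ((ρ.comp (T ^ i) : O →+* ZMod m) : O →* ZMod m) v)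
  rw [hm, pow_mul] at h
  simpa [RingHom.coe_pow] using congrArg Units.val h

theorem map_hornerHom_map {O : Type*} [CommRing O] (T : O →+* O) {m p e c n : ℕ}
    (hm : Nat.totient m = e * p) (ρ : O →+* ZMod m) (hT : ∀ v, T^[n] v = v)
    (hc : c ^ n ≡ 1 [MOD p]) (v : Oˣ) :
    Units.map (hornerHom T ρ c e n) (Units.map (T : O →* O) v) =
      Units.map (hornerHom T ρ c e n) v ^ c := by
  apply Units.ext
  refine hornerHom_map T ρ hT hc (v.isUnit.map ρ) ?_
  have h := ZMod.pow_totient (Units.map (ρ : O →* ZMod m) v)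
  rw [hm, pow_mul] at h
  simpa using congrArg Units.val h

theorem hornerHom_units_eq_one {K : Type*} [Field K] [NumberField K] {p k : ℕ} (hp : p.Prime)
    (hp2 : p ≠ 2) (hKp : Module.finrank ℚ K < p - 1) (hK : Module.finrank ℚ K ≤ 2 ^ (k + 1))
    {S : 𝓞 K →+* 𝓞 K} (hS : ∀ x, S^[2 ^ (k + 1)] x = x) {c : ℕ} (hc : p ∣ c ^ 2 ^ k + 1)
    {m₁ m₂ e₁ e₂ : ℕ} (hm₁ : m₁.totient = e₁ * p) (hm₂ : m₂.totient = e₂ * p)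
    (ρ₁ : 𝓞 K →+* ZMod m₁) (ρ₂ : 𝓞 K →+* ZMod m₂) {η : 𝓞 K} (hη : IsUnit η)
    (hη₁ : hornerHom S ρ₁ c e₁ (2 ^ (k + 1)) η = 1)
    (hη₂ : hornerHom S ρ₂ c e₂ (2 ^ (k + 1)) η ≠ 1) (ε : (𝓞 K)ˣ) :
    hornerHom S ρ₁ c e₁ (2 ^ (k + 1)) ε = 1 := by
  obtain ⟨η, rfl⟩ := hη
  have hc' : c ^ 2 ^ (k + 1) ≡ 1 [MOD p] := by
    rw [← ZMod.natCast_eq_natCast_iff]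
    have h := (ZMod.natCast_eq_zero_iff _ _).2 hc
    push_cast at h ⊢
    rw [pow_succ, pow_mul, eq_neg_of_add_eq_zero_left h, neg_one_sq]
  have h := unit_character_eq_one hp hp2 hKp hK hS hc
    (ψ := Units.map (hornerHom S ρ₁ c e₁ (2 ^ (k + 1))))
    (φ := Units.map (hornerHom S ρ₂ c e₂ (2 ^ (k + 1))))
    (map_hornerHom_pow_eq_one S hm₁ ρ₁ c _) (map_hornerHom_pow_eq_one S hm₂ ρ₂ c _)
    (map_hornerHom_map S hm₁ ρ₁ hS hc') (map_hornerHom_map S hm₂ ρ₂ hS hc') (η := η)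
    (Units.ext hη₁) (fun h => hη₂ (congrArg Units.val h)) ε
  exact congrArg Units.val h

theorem dvd_card_classGroup_of_hornerHom_ne_one {K L : Type*} (M : Type*) [Field K] [NumberField K]
    [Field L] [NumberField L] [Field M] [NumberField M] [Algebra K L] [Algebra L M] [IsGalois K L]
    {m : ℕ} [NeZero m] [IsCyclotomicExtension {m} ℚ M] {p e : ℕ} (hp : p.Prime)
    (S : 𝓞 K →+* 𝓞 K) (hS : ∀ y, y ∣ algebraMap ℤ (𝓞 K) (Algebra.norm ℤ y))
    {m₁ c n : ℕ} (hm₁ : m₁.totient = e * p) (ρ : 𝓞 K →+* ZMod m₁)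
    (hnorm : ∀ (β : 𝓞 L) (i : ℕ), IsUnit (ρ (S^[i] (RingOfIntegers.norm K β))) →
      ρ (S^[i] (RingOfIntegers.norm K β)) ^ e = 1)
    (hunit : ∀ ε : (𝓞 K)ˣ, hornerHom S ρ c e n ε = 1) {α : 𝓞 K} {q r : ℕ} (hq : q.Prime)
    (hα : (Algebra.norm ℤ α).natAbs = q) (hqm : ¬ q ∣ m) (hqm₁ : q.Coprime m₁)
    (hqr : (q : ZMod m) ^ r = 1) (hr : ¬ p ∣ r) (hα' : hornerHom S ρ c e n α ≠ 1) :
    p ∣ Nat.card (ClassGroup (𝓞 L)) := by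
  by_contra hcard
  obtain ⟨Q, f, hQ0, hf, hQ⟩ := exists_relNorm_eq_span_pow (L := L) M hq hqm hα
  obtain ⟨β, ε, hβ⟩ := exists_norm_eq_unit_mul_pow hQ0 hQ
  have hαu : ∀ i, IsUnit (ρ (S^[i] α)) := by
    intro i
    have h := map_dvd (ρ.comp (S ^ i : 𝓞 K →+* 𝓞 K)) (hS α)
    rw [eq_intCast, map_intCast, RingHom.comp_apply, RingHom.coe_pow] at h
    refine isUnit_of_dvd_unit h ?_
    have hu := (ZMod.isUnit_iff_coprime q m₁).2 hqm₁
    rw [← hα] at hu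
    rcases Int.natAbs_eq (Algebra.norm ℤ α) with h | h
    · rw [h]
      simpa using hu
    · rw [h]
      simpa using hu
  have hHα : hornerHom S ρ c e n α ^ p = 1 := by
    refine hornerHom_pow_eq_one S ρ n fun i => ?_
    have h := ZMod.pow_totient (hαu i).unit
    rw [hm₁, pow_mul] at h
    simpa using congrArg Units.val h
  have hHβ : hornerHom S ρ c e n (RingOfIntegers.norm K β) = 1 := by
    refine hornerHom_eq_one S ρ n fun i => hnorm β i ?_
    rw [hβ, ← RingHom.coe_pow, map_mul, map_mul, map_pow, map_pow]
    refine IsUnit.mul ((ε.isUnit.map _).map _) (IsUnit.pow _ ?_)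
    rw [RingHom.coe_pow]
    exact hαu i
  rw [hβ, map_mul, hunit, one_mul, map_pow] at hHβ
  have hcop : p.Coprime (f * Nat.card (ClassGroup (𝓞 L))) := by
    rw [hp.coprime_iff_not_dvd, hp.dvd_mul, not_or]
    exact ⟨fun h => hr (h.trans (hf.trans (orderOf_dvd_of_pow_eq_one hqr))), hcard⟩
  have h := pow_gcd_eq_one.2 ⟨hHα, hHβ⟩
  rw [hcop.gcd_eq_one, pow_one] at h
  exact hα' h

end ClassNumber

section ClassNumberNumerical

open NumberField Polynomial

theorem prime_114689 : Nat.Prime 114689 := by norm_num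

theorem totient_sq : Nat.totient (114689 ^ 2) = 448 * 256 * 114689 := by
  rw [Nat.totient_prime_pow prime_114689 (by norm_num)]
  norm_num

theorem totient_auxiliary : Nat.totient 19730178049 = 672 * 256 * 114689 :=
  Nat.totient_prime prime_auxiliary

theorem pow_eq_one_of_pow_eq_one {x : ZMod (114689 ^ 2)} (hx : IsUnit x)
    (h : x ^ (2 * (2 * 114688)) = 1) : x ^ (448 * 256) = 1 := by
  have h1 := ZMod.pow_totient hx.unit
  rw [totient_sq] at h1
  have h2 : x ^ (448 * 256 * 114689) = 1 := by simpa using congrArg Units.val h1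
  have h3 := pow_gcd_eq_one.2 ⟨h, h2⟩
  rwa [show Nat.gcd (2 * (2 * 114688)) (448 * 256 * 114689) = 448 * 256 by norm_num] at h3

/-- The data at the primes above `114689` and above the auxiliary prime `19730178049`. -/
theorem exists_residue_maps {K : Type*} [Field K] {S : 𝓞 K →+* 𝓞 K} {w : ℕ → 𝓞 K}
    (hw : ∀ d, S (w d) = w (1963 * d))
    (hρ : ∀ (R : Type) [CommRing R] (z : R), (cyclotomic 4096 R).eval z = 0 →
      ∃ ρ : 𝓞 K →+* R, ∀ d, ρ (w d) = z ^ d + z ^ (4095 * d)) :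
    ∃ (ρ₁ : 𝓞 K →+* ZMod (114689 ^ 2)) (ρ₂ : 𝓞 K →+* ZMod 19730178049),
      IsUnit (ρ₁ (∏ j ∈ Finset.range 1023, (S^[j + 1] (w 1) - w 1))) ∧
      hornerHom S ρ₁ 181 (448 * 256) (2 ^ (9 + 1)) (1 + ([1].map w).sum) = 1 ∧
      hornerHom S ρ₂ 181 (672 * 256) (2 ^ (9 + 1)) (1 + ([1].map w).sum) ≠ 1 ∧
      hornerHom S ρ₁ 181 (448 * 256) (2 ^ (9 + 1))
        (1 + ([1, 508, 774, 1538].map w).sum) ≠ 1 := by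
  have hpow : ∀ {m z : ℕ}, (z : ZMod m) ^ 2048 + 1 = 0 → (z : ZMod m) ^ 4096 = 1 := by
    intro m z hz
    linear_combination ((z : ZMod m) ^ 2048 - 1) * hz
  have hz₁ : ((637333705 : ℕ) : ZMod (114689 ^ 2)) ^ 2048 + 1 = 0 :=
    natCast_pow_add_one_eq_zero (by decide +kernel)
  have hz₂ : ((11669485081 : ℕ) : ZMod 19730178049) ^ 2048 + 1 = 0 :=
    natCast_pow_add_one_eq_zero (by decide +kernel)
  obtain ⟨ρ₁, hρ₁⟩ := hρ _ _ (eval_cyclotomic_eq_zero hz₁)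
  obtain ⟨ρ₂, hρ₂⟩ := hρ _ _ (eval_cyclotomic_eq_zero hz₂)
  have h1024 : 2 ^ (9 + 1) = 1024 := by norm_num
  refine ⟨ρ₁, ρ₂, ?_, ?_, ?_, ?_⟩
  · rw [map_prod_sub_eq_diffProdVal hw (hpow hz₁) hρ₁ (by norm_num), ZMod.isUnit_iff_coprime]
    exact diffProdVal_coprime.pow_right 2
  · rw [hornerHom_eq_hornerVal hw (hpow hz₁) hρ₁, h1024, hornerVal_unit, Nat.cast_one]
  · rw [hornerHom_eq_hornerVal hw (hpow hz₂) hρ₂, h1024, hornerVal_unit_auxiliary,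
      ← Nat.cast_one, Ne, ZMod.natCast_eq_natCast_iff]
    decide +kernel
  · rw [hornerHom_eq_hornerVal hw (hpow hz₁) hρ₁, h1024, hornerVal_prime,
      ← Nat.cast_one, Ne, ZMod.natCast_eq_natCast_iff]
    decide +kernel

theorem dvd_card_classGroup {K L M : Type*} [Field K] [NumberField K] [Field L] [NumberField L]
    [Field M] [NumberField M] [Algebra K L] [Algebra L M]
    (hK : Module.finrank ℚ K = 1024) [IsGalois K L] [IsCyclotomicExtension {4096 * 114689 ^ 2} ℚ M]
    (hLM : Module.finrank L M = 2 * 114688) {T : K ≃ₐ[ℚ] K} {w : ℕ → 𝓞 K}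
    (hw : ∀ d, RingOfIntegers.mapRingHom (T : K →+* K) (w d) = w (1963 * d))
    (hρ : ∀ (R : Type) [CommRing R] (z : R), (cyclotomic 4096 R).eval z = 0 →
      ∃ ρ : 𝓞 K →+* R, ∀ d, ρ (w d) = z ^ d + z ^ (4095 * d)) :
    114689 ∣ Nat.card (ClassGroup (𝓞 L)) := by
  obtain ⟨ρ₁, ρ₂, hdiff, hη₁, hη₂, hα'⟩ := exists_residue_maps hw hρ
  set S := RingOfIntegers.mapRingHom (T : K →+* K) with hS
  have hne : ∀ i, 0 < i → i < Module.finrank ℚ K → T^[i] (w 1 : K) ≠ w 1 := by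
    intro i hi0 hi h
    obtain ⟨j, rfl⟩ := Nat.exists_eq_succ_of_ne_zero hi0.ne'
    have h0 : S^[j + 1] (w 1) - w 1 = 0 := by
      rw [sub_eq_zero]
      apply RingOfIntegers.ext
      rw [hS, coe_iterate_mapRingHom]
      exact h
    have : Fact (1 < 114689 ^ 2) := ⟨by norm_num⟩
    rw [Finset.prod_eq_zero (Finset.mem_range.2 (by rw [hK] at hi; omega)) h0, map_zero] at hdiff
    exact not_isUnit_zero hdiff
  obtain ⟨hgal, hT, hbij⟩ := isGalois_of_iterate_ne T hne
  have hSK : ∀ y : 𝓞 K, S^[Module.finrank ℚ K] y = y := by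
    intro y
    apply RingOfIntegers.ext
    rw [hS, coe_iterate_mapRingHom]
    exact hT y
  have hS1024 : ∀ y : 𝓞 K, S^[2 ^ (9 + 1)] y = y := by rwa [hK] at hSK
  obtain ⟨e, he, he'⟩ := exists_eq_one_and_iterate_eq_zero S ρ₁ (w 1) hdiff
  obtain ⟨m, z, q, hz, hq, hη, hα, hbη, hbα, hqm, hq1⟩ := exists_norm_residues
  have hNη := norm_eq_of_prodVal_eq hK hbij hw hρ hz [1] (-((1 : ℕ) : ℤ)) hη hbη
  have hNα := norm_eq_of_prodVal_eq hK hbij hw hρ hz [1, 508, 774, 1538] (-(q : ℤ)) hα hbα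
  have hηu : IsUnit (1 + ([1].map w).sum) := by
    rw [NumberField.isUnit_iff_norm, RingOfIntegers.coe_norm, ← Algebra.coe_norm_int, hNη]
    norm_num
  have hunit := hornerHom_units_eq_one (k := 9) prime_114689 (by norm_num)
    (by rw [hK]; norm_num) (by rw [hK]; norm_num) hS1024 (c := 181) (by decide +kernel)
    totient_sq totient_auxiliary ρ₁ ρ₂ hηu hη₁ hη₂
  obtain ⟨ζ, hζ⟩ := IsCyclotomicExtension.exists_isPrimitiveRoot ℚ M
    (Set.mem_singleton (4096 * 114689 ^ 2)) (by norm_num)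
  have hζ' : IsPrimitiveRoot (ζ ^ 4096) (114689 ^ 2) := hζ.pow (by norm_num) rfl
  refine dvd_card_classGroup_of_hornerHom_ne_one M prime_114689 S (fun y => ?_) totient_sq ρ₁
    (fun β i hβ => ?_) hunit hq (by rw [hNα, Int.natAbs_neg, Int.natAbs_natCast]) hqm ?_
    (r := 114688) ?_ (by norm_num) hα'
  · rw [← prod_iterate_eq_norm hbij y]
    exact Finset.dvd_prod_of_mem (fun i => S^[i] y) (a := 0)
      (Finset.mem_range.2 Module.finrank_pos)
  · refine pow_eq_one_of_pow_eq_one hβ ?_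
    rw [← hLM]
    refine map_iterate_norm_pow_eq_one hbij hSK hζ' ρ₁ he (fun i hi => he' i ?_) β i hβ
    rw [hK] at hi
    omega
  · rw [hq.coprime_iff_not_dvd]
    exact fun h => hqm (h.mul_left _)
  · rw [← Nat.cast_pow, ← Nat.cast_one, ZMod.natCast_eq_natCast_iff, Nat.ModEq, hq1]
    norm_num

end ClassNumberNumerical

section MaximalRealSubfield

open NumberField IntermediateField Polynomial

theorem isCyclotomicExtension_adjoin {n : ℕ} [NeZero n] {z : ℂ} (hz : IsPrimitiveRoot z n) :
    IsCyclotomicExtension {n} ℚ (adjoin ℚ {z}) := by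
  change IsCyclotomicExtension {n} ℚ (adjoin ℚ {z}).toSubalgebra
  rw [adjoin_simple_toSubalgebra_of_isAlgebraic
    ((hz.isIntegral (NeZero.pos n)).tower_top (A := ℚ)).isAlgebraic]
  exact hz.adjoin_isCyclotomicExtension ℚ

theorem add_pow_mem_and_finrank_of_isMaximalReal {K : IntermediateField ℚ ℂ} {n : ℕ} [NeZero n]
    (hn : 2 < n) {z : ℂ} (hz : IsPrimitiveRoot z n) (hK : K ≤ adjoin ℚ {z})
    (hKreal : ∀ x ∈ K, (starRingEnd ℂ) x = x)
    (hKmax : ∀ B : IntermediateField ℚ ℂ, B ≤ adjoin ℚ {z} →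
      (∀ x ∈ B, (starRingEnd ℂ) x = x) → B ≤ K) :
    z + z ^ (n - 1) ∈ K ∧ Module.finrank ℚ K * 2 = n.totient := by
  have hinv : z * z ^ (n - 1) = 1 := by
    rw [← pow_succ', Nat.sub_add_cancel NeZero.one_le, hz.pow_eq_one]
  have hconj : (starRingEnd ℂ) z = z ^ (n - 1) := by
    rw [← Complex.inv_eq_conj (Complex.norm_eq_one_of_pow_eq_one hz.pow_eq_one (NeZero.ne n))]
    exact inv_eq_of_mul_eq_one_right hinv
  have hmem : z + z ^ (n - 1) ∈ K := by
    refine hKmax (adjoin ℚ {z + z ^ (n - 1)}) ?_ ?_ (mem_adjoin_simple_self ℚ _)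
    · rw [adjoin_simple_le_iff]
      exact add_mem (mem_adjoin_simple_self ℚ z) (pow_mem (mem_adjoin_simple_self ℚ z) _)
    · intro x hx
      induction hx using adjoin_induction with
      | mem x hx =>
        rw [Set.mem_singleton_iff.1 hx, map_add, ← hconj, Complex.conj_conj, add_comm]
      | algebraMap x => exact map_ratCast _ x
      | add x y _ _ hx hy => rw [map_add, hx, hy]
      | inv x _ hx => rw [map_inv₀, hx]
      | mul x y _ _ hx hy => rw [map_mul, hx, hy]
  refine ⟨hmem, ?_⟩
  have hcyc := isCyclotomicExtension_adjoin hz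
  have hrel := relfinrank_mul_relfinrank (bot_le : ⊥ ≤ K) hK
  rw [relfinrank_bot_left, relfinrank_bot_left, IsCyclotomicExtension.Rat.finrank n (adjoin ℚ {z}),
    relfinrank_eq_finrank_of_le hK, extendScalars_adjoin hK] at hrel
  have hint : IsIntegral K z := (hz.isIntegral (NeZero.pos n)).tower_top
  rw [adjoin.finrank hint] at hrel
  rw [← hrel]
  congr 1
  refine le_antisymm ((minpoly.two_le_natDegree_iff hint).2 ?_) ?_
  · rintro ⟨y, hy⟩
    have h1 := hKreal y y.2
    change (y : ℂ) = z at hy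
    rw [hy, hconj] at h1
    rw [h1, ← sq] at hinv
    exact absurd (Nat.le_of_dvd two_pos (hz.dvd_of_pow_eq_one 2 hinv)) (by omega)
  · have hq : (X ^ 2 - C (⟨_, hmem⟩ : K) * X + 1 : K[X]).natDegree = 2 := by
      compute_degree!
    rw [← hq]
    refine natDegree_le_of_dvd (minpoly.dvd _ _ ?_) (ne_zero_of_natDegree_gt (hq ▸ two_pos))
    have : algebraMap K ℂ ⟨_, hmem⟩ = z + z ^ (n - 1) := rfl
    simp only [map_add, map_sub, map_mul, map_pow, aeval_X, aeval_C, map_one, this]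
    linear_combination -hinv

end MaximalRealSubfield

/-- `114689` divides the class number of the compositum `ℚ(2¹⁰)·ℚ(114689)`, where `ℚ(2¹⁰)` is the
maximal real subfield of `ℚ(ζ_{2¹²})` (the `10`-th layer of the cyclotomic `ℤ₂`-extension
of `ℚ`) and `ℚ(114689)` is the unique degree-`114689` subfield of `ℚ(ζ_{114689²})`, the
compositum being taken inside `ℂ`. -/
theorem p114689_dvd_classNumber
    (K₁ K₂ : IntermediateField ℚ ℂ)
    (ζ : ℂ) (hζ : IsPrimitiveRoot ζ (2 ^ 12))
    (hK₁sub : K₁ ≤ IntermediateField.adjoin ℚ {ζ})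
    (hK₁real : ∀ x ∈ K₁, (starRingEnd ℂ) x = x)
    (hK₁max : ∀ B : IntermediateField ℚ ℂ, B ≤ IntermediateField.adjoin ℚ {ζ} →
      (∀ x ∈ B, (starRingEnd ℂ) x = x) → B ≤ K₁)
    (ξ : ℂ) (hξ : IsPrimitiveRoot ξ (114689 ^ 2))
    (hK₂sub : K₂ ≤ IntermediateField.adjoin ℚ {ξ})
    (hK₂deg : Module.finrank ℚ K₂ = 114689) :
    114689 ∣ Nat.card (ClassGroup (𝓞 ↥(K₁ ⊔ K₂))) := by
  replace hζ : IsPrimitiveRoot ζ 4096 := by simpa using hζ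
  obtain ⟨hω, hdeg⟩ :=
    add_pow_mem_and_finrank_of_isMaximalReal (by norm_num) hζ hK₁sub hK₁real hK₁max
  have hK₁deg : Module.finrank ℚ K₁ = 1024 := by
    rw [show 4096 = 2 ^ 12 by norm_num, Nat.totient_prime_pow Nat.prime_two (by norm_num)] at hdeg
    omega
  have hLdeg : Module.finrank ℚ ↥(K₁ ⊔ K₂) = 1024 * 114689 := by
    rw [(IntermediateField.LinearDisjoint.of_finrank_coprime _).finrank_sup, hK₁deg, hK₂deg]
    rw [hK₁deg, hK₂deg]
    norm_num
  have hμ : IsPrimitiveRoot (ζ * ξ) (4096 * 114689 ^ 2) := by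
    have h := (Commute.all ζ ξ).orderOf_mul_eq_mul_orderOf_of_coprime
      (by rw [← hζ.eq_orderOf, ← hξ.eq_orderOf]; norm_num)
    rw [← hζ.eq_orderOf, ← hξ.eq_orderOf] at h
    exact h ▸ IsPrimitiveRoot.orderOf _
  have : NeZero (4096 * 114689 ^ 2) := ⟨by norm_num⟩
  set M := IntermediateField.adjoin ℚ {ζ * ξ} with hM
  have hμM : ζ * ξ ∈ M := IntermediateField.mem_adjoin_simple_self ℚ _
  have hζM : ζ ∈ M := by
    have h : (ζ * ξ) ^ 114689 ^ 2 = ζ := by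
      rw [mul_pow, hξ.pow_eq_one, mul_one, show 114689 ^ 2 = 4096 * 3211320 + 1 by norm_num,
        pow_succ, pow_mul, hζ.pow_eq_one, one_pow, one_mul]
    rw [← h]
    exact pow_mem hμM _
  have hξM : ξ ∈ M := by
    convert div_mem hμM hζM using 1
    rw [mul_div_cancel_left₀ _ (hζ.ne_zero (by norm_num))]
  have hLM : K₁ ⊔ K₂ ≤ M :=
    sup_le (hK₁sub.trans (IntermediateField.adjoin_simple_le_iff.2 hζM))
      (hK₂sub.trans (IntermediateField.adjoin_simple_le_iff.2 hξM))
  have hcycM : IsCyclotomicExtension {4096 * 114689 ^ 2} ℚ M := isCyclotomicExtension_adjoin hμ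
  have hcyc : IsCyclotomicExtension {4096} ℚ (IntermediateField.adjoin ℚ {ζ}) :=
    isCyclotomicExtension_adjoin hζ
  have hMdeg : Module.finrank ℚ M = 1024 * 114689 * (2 * 114688) := by
    rw [IsCyclotomicExtension.Rat.finrank (4096 * 114689 ^ 2) M,
      Nat.totient_mul (by norm_num), totient_sq, show 4096 = 2 ^ 12 by norm_num,
      Nat.totient_prime_pow Nat.prime_two (by norm_num)]
    norm_num
  have : NumberField M := IsCyclotomicExtension.numberField {4096 * 114689 ^ 2} ℚ M
  have : NumberField (IntermediateField.adjoin ℚ {ζ}) :=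
    IsCyclotomicExtension.numberField {4096} ℚ _
  have : FiniteDimensional ℚ ↥(K₁ ⊔ K₂) := Module.finite_of_finrank_pos (by rw [hLdeg]; norm_num)
  have : FiniteDimensional ℚ K₁ := Module.finite_of_finrank_pos (by rw [hK₁deg]; norm_num)
  have : NumberField ↥(K₁ ⊔ K₂) := ⟨⟩
  have : NumberField K₁ := ⟨⟩
  let : Algebra ↥(K₁ ⊔ K₂) M := (IntermediateField.inclusion hLM).toAlgebra
  let : Algebra K₁ ↥(K₁ ⊔ K₂) := (IntermediateField.inclusion le_sup_left).toAlgebra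
  let : Algebra K₁ (IntermediateField.adjoin ℚ {ζ}) :=
    (IntermediateField.inclusion hK₁sub).toAlgebra
  have : IsAbelianGalois ℚ M := IsCyclotomicExtension.isAbelianGalois {4096 * 114689 ^ 2} ℚ M
  have : IsAbelianGalois ℚ ↥(K₁ ⊔ K₂) := IsAbelianGalois.tower_bot ℚ _ M
  have : IsGalois K₁ ↥(K₁ ⊔ K₂) := IsGalois.tower_top_of_isGalois ℚ K₁ _
  have hfin : Module.finrank ↥(K₁ ⊔ K₂) M = 2 * 114688 := by
    have h := Module.finrank_mul_finrank ℚ ↥(K₁ ⊔ K₂) M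
    rw [hLdeg, hMdeg] at h
    exact mul_left_cancel₀ (by norm_num) h
  have hζ' : IsPrimitiveRoot (IntermediateField.AdjoinSimple.gen ℚ ζ) 4096 :=
    IsPrimitiveRoot.coe_submonoidClass_iff.mp hζ
  obtain ⟨T, w, hw, hρ⟩ := exists_conjugation_sums (K := K₁) (g := 1963) (by norm_num) hζ'
    (ω := ⟨_, hω⟩) rfl
  exact dvd_card_classGroup hK₁deg hfin hw hρ
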